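/- arXiv:2201.04889 — 2 statements merged into one kernel-verified Lean document; each statement's English description precedes it below -/
import Mathlib

section
/- Let G be a simple graph on n ≥ 18 vertices. If e(G) > (n² − 3n + 3)/2, then G contains the 2-power of a Hamilton cycle, unless G is a subgraph of one of the three graphs K_n \ E(S_{n−3}), K_n \ E(S_{n−4} ∪ S_4), or K_n \ E(S_{n−4} ∪ K_3). -/
/-- The 2-power `Cₙ²` of the cycle on `n` vertices: vertices are `ZMod n`, with
two distinct vertices adjacent iff their (cyclic) distance on the cycle is at most 2. -/
def cycleSq (n : ℕ) : SimpleGraph (ZMod n) :=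
  SimpleGraph.fromRel (fun u v => v - u = 1 ∨ v - u = 2)

/-- `Contains G F`: the graph `G` contains a (not necessarily induced) copy of `F`. -/
def Contains {V W : Type*} (G : SimpleGraph V) (F : SimpleGraph W) : Prop :=
  ∃ f : W ↪ V, ∀ ⦃a b⦄, F.Adj a b → G.Adj (f a) (f b)

/-- `K_n \ E(S_{n-3})`: the complete graph on `n` vertices minus the edges of a star
`S_{n-3}` with center `0` and leaves `1, …, n-4`. -/
def KnDelS (n : ℕ) : SimpleGraph (Fin n) :=
  ⊤ \ SimpleGraph.fromRel (fun u v => u.val = 0 ∧ 1 ≤ v.val ∧ v.val ≤ n - 4)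

/-- `K_n \ E(S_{n-4} ∪ S_4)`: the complete graph on `n` vertices minus the edges of a star
`S_{n-4}` (center `0`, leaves `1, …, n-5`) and of a disjoint star `S_4` (center `n-4`,
leaves `n-3, n-2, n-1`). -/
def KnDelSS (n : ℕ) : SimpleGraph (Fin n) :=
  ⊤ \ SimpleGraph.fromRel (fun u v =>
    (u.val = 0 ∧ 1 ≤ v.val ∧ v.val ≤ n - 5) ∨ (u.val = n - 4 ∧ n - 3 ≤ v.val))

/-- `K_n \ E(S_{n-4} ∪ K_3)`: the complete graph on `n` vertices minus the edges of a star
`S_{n-4}` (center `0`, leaves `1, …, n-5`) and of a disjoint triangle `K_3` on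
`{n-3, n-2, n-1}`. -/
def KnDelSK (n : ℕ) : SimpleGraph (Fin n) :=
  ⊤ \ SimpleGraph.fromRel (fun u v =>
    (u.val = 0 ∧ 1 ≤ v.val ∧ v.val ≤ n - 5) ∨ (n - 3 ≤ u.val ∧ n - 3 ≤ v.val))

namespace CycleSquare
open Finset

lemma four_vertices : ∀ ab ac ad bc bd cd : Bool,
    2 * (ab.toNat + ac.toNat + ad.toNat + bc.toNat + bd.toNat + cd.toNat) ≤ 6 →
    (ab || bc || cd) →
    (ab || bd || cd) →
    (ac || bc || bd) →
    (ac || cd || bd) →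
    (ad || bd || bc) →
    (ad || cd || bc) →
    (ab || ac || cd) →
    (ab || ad || cd) →
    (ac || ab || bd) →
    (ac || ad || bd) →
    (ad || ab || bc) →
    (ad || ac || bc) →
    !(ab && bc && ac) →
    !(ab && bd && ad) →
    !(ac && cd && ad) →
    !(bc && cd && bd) →
    !(ab && ac && ad) →
    !(ab && bc && bd) →
    !(ac && bc && cd) →
    !(ad && bd && cd) →
    False := by
  intro ab ac ad bc bd cd
  cases ab <;> cases ac <;> cases ad <;> cases bc <;> cases bd <;> cases cd <;> simp

open scoped Classical

section Packing

variable {V : Type*} {H : SimpleGraph V} {S T U : Finset V} {x y : V}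

/-- The number of neighbours of `x` lying in `S`. -/
noncomputable def deg (H : SimpleGraph V) (S : Finset V) (x : V) : ℕ := #{y ∈ S | H.Adj x y}

/-- The degree sum of the subgraph induced on `S`. -/
noncomputable def vol (H : SimpleGraph V) (S : Finset V) : ℕ := ∑ x ∈ S, deg H S x

/-- The vertices of `S` with a neighbour in `S`. -/
noncomputable def nonisolated (H : SimpleGraph V) (S : Finset V) : Finset V :=
  {x ∈ S | 0 < deg H S x}

/-- `f` lists the elements of `S` cyclically so that elements at cyclic distance at most two are
never adjacent in `H`. -/
structure IsPacking (H : SimpleGraph V) (S : Finset V) (f : ℕ → V) : Prop where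
  mem : ∀ i < #S, f i ∈ S
  ne : ∀ i j, i < j → j < #S → f i ≠ f j
  not_adj : ∀ i j, i < j → j < #S → (j ≤ i + 2 ∨ #S + i ≤ j + 2) → ¬ H.Adj (f i) (f j)

/-- The square of a Hamilton cycle on `S` exists in the complement of `H`. -/
def Packs (H : SimpleGraph V) (S : Finset V) : Prop := ∃ f, IsPacking H S f

lemma deg_mono (h : S ⊆ T) (x : V) : deg H S x ≤ deg H T x :=
  card_le_card (filter_subset_filter _ h)

lemma vol_mono (h : S ⊆ T) : vol H S ≤ vol H T :=
  (sum_le_sum fun x _ => deg_mono h x).trans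
    (sum_le_sum_of_subset_of_nonneg h fun _ _ _ => Nat.zero_le _)

lemma deg_insert (hx : x ∉ S) (y : V) :
    deg H (insert x S) y = deg H S y + if H.Adj y x then 1 else 0 := by
  unfold deg
  rw [filter_insert]
  split_ifs with h
  · rw [card_insert_of_notMem (by simp [hx])]
  · rfl

lemma deg_insert_self : deg H (insert x S) x = deg H S x := by
  unfold deg
  rw [filter_insert, if_neg (H.loopless.irrefl x)]

lemma deg_erase_self : deg H (S.erase x) x = deg H S x := by
  by_cases h : x ∈ S
  · conv_rhs => rw [← insert_erase h, deg_insert_self]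
  · rw [erase_eq_of_notMem h]

lemma vol_insert (hx : x ∉ S) : vol H (insert x S) = vol H S + 2 * deg H S x := by
  unfold vol
  rw [sum_insert hx, deg_insert_self, sum_congr rfl fun y _ => deg_insert hx y, sum_add_distrib]
  have : (∑ y ∈ S, if H.Adj y x then 1 else 0) = deg H S x := by
    rw [deg, card_filter]
    exact sum_congr rfl fun y _ => by simp [H.adj_comm]
  omega

lemma vol_erase (hx : x ∈ S) : vol H S = vol H (S.erase x) + 2 * deg H S x := by
  conv_lhs => rw [← insert_erase hx, vol_insert (notMem_erase x S), deg_erase_self]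

lemma deg_pos_iff : 0 < deg H S x ↔ ∃ y ∈ S, H.Adj x y := by
  simp [deg, card_pos, filter_nonempty_iff]

lemma nonisolated_subset : nonisolated H S ⊆ S := filter_subset _ _

lemma mem_nonisolated : x ∈ nonisolated H S ↔ x ∈ S ∧ 0 < deg H S x := mem_filter

lemma IsPacking.surj {f : ℕ → V} (hf : IsPacking H S f) (hy : y ∈ S) : ∃ i < #S, f i = y := by
  have hinj : Set.InjOn f (range #S) := by
    intro i hi j hj hij
    simp only [coe_range, Set.mem_Iio] at hi hj
    rcases lt_trichotomy i j with h | h | h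
    · exact (hf.ne i j h hj hij).elim
    · exact h
    · exact (hf.ne j i h hi hij.symm).elim
  have himg : (range #S).image f = S :=
    eq_of_subset_of_card_le (image_subset_iff.2 fun i hi => hf.mem i (mem_range.1 hi))
      (by rw [card_image_of_injOn hinj, card_range])
  rw [← himg] at hy
  simpa using hy

lemma IsPacking.injOn {f : ℕ → V} (hf : IsPacking H S f) :
    ∀ i < #S, ∀ j < #S, f i = f j → i = j := by
  intro i hi j hj hij
  rcases lt_trichotomy i j with h | h | h
  · exact (hf.ne i j h hj hij).elim
  · exact h
  · exact (hf.ne j i h hi hij.symm).elim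

/-- The index `i + r` modulo `m`, for `i, r < m`. -/
def rot (m r i : ℕ) : ℕ := if i + r < m then i + r else i + r - m

lemma IsPacking.rotate {f : ℕ → V} (hf : IsPacking H S f) {r : ℕ} (hr : r < #S) :
    IsPacking H S fun i => f (rot #S r i) := by
  refine ⟨fun i hi => hf.mem _ ?_, fun i j hij hj h => ?_, fun i j hij hj h => ?_⟩
  · unfold rot; split_ifs <;> omega
  · have := hf.injOn _ (by unfold rot; split_ifs <;> omega) _ (by unfold rot; split_ifs <;> omega) h
    unfold rot at this
    split_ifs at this <;> omega
  · unfold rot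
    split_ifs
    · exact hf.not_adj _ _ (by omega) (by omega) (by omega)
    · intro h'
      exact hf.not_adj _ _ (by omega) (by omega) (by omega) h'.symm
    · omega
    · exact hf.not_adj _ _ (by omega) (by omega) (by omega)

/-- The number of rotations moving a given index to a neighbour of `x` is at most the degree. -/
lemma IsPacking.card_rot_le {f : ℕ → V} (hf : IsPacking H S f) (x : V) {i : ℕ} (hi : i < #S) :
    #{r ∈ range #S | H.Adj x (f (rot #S r i))} ≤ deg H S x := by
  refine card_le_card_of_injOn (fun r => f (rot #S r i)) (fun r hr => ?_) fun r hr s hs h => ?_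
  · rw [mem_coe, mem_filter, mem_range] at hr
    rw [mem_coe, mem_filter]
    exact ⟨hf.mem _ (by unfold rot; split_ifs <;> omega), hr.2⟩
  · rw [mem_coe, mem_filter, mem_range] at hr hs
    have := hf.injOn _ (by unfold rot; split_ifs <;> omega) _ (by unfold rot; split_ifs <;> omega) h
    unfold rot at this
    split_ifs at this <;> omega

lemma Packs.insert_vertex (h : Packs H S) (hx : x ∉ S) (hd : 4 * deg H S x < #S) :
    Packs H (insert x S) := by
  obtain ⟨f, hf⟩ := h
  obtain ⟨r, hr, h0, h1, h2, h3⟩ : ∃ r < #S, ¬ H.Adj x (f (rot #S r 0)) ∧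
      ¬ H.Adj x (f (rot #S r (min 1 (#S - 1)))) ∧ ¬ H.Adj x (f (rot #S r (#S - 1))) ∧
      ¬ H.Adj x (f (rot #S r (#S - 2))) := by
    by_contra! hcon
    have hsub : range #S ⊆ {r ∈ range #S | H.Adj x (f (rot #S r 0))} ∪
        {r ∈ range #S | H.Adj x (f (rot #S r (min 1 (#S - 1))))} ∪
        {r ∈ range #S | H.Adj x (f (rot #S r (#S - 1)))} ∪
        {r ∈ range #S | H.Adj x (f (rot #S r (#S - 2)))} := by
      intro r hr
      have := hcon r (mem_range.1 hr)
      simp only [mem_union, mem_filter, hr, true_and]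
      tauto
    have := card_le_card hsub
    have e0 := hf.card_rot_le x (i := 0) (by omega)
    have e1 := hf.card_rot_le x (i := min 1 (#S - 1)) (by omega)
    have e2 := hf.card_rot_le x (i := #S - 1) (by omega)
    have e3 := hf.card_rot_le x (i := #S - 2) (by omega)
    have u1 := card_union_le ({r ∈ range #S | H.Adj x (f (rot #S r 0))} ∪
        {r ∈ range #S | H.Adj x (f (rot #S r (min 1 (#S - 1))))} ∪
        {r ∈ range #S | H.Adj x (f (rot #S r (#S - 1)))})
        {r ∈ range #S | H.Adj x (f (rot #S r (#S - 2)))}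
    have u2 := card_union_le ({r ∈ range #S | H.Adj x (f (rot #S r 0))} ∪
        {r ∈ range #S | H.Adj x (f (rot #S r (min 1 (#S - 1))))})
        {r ∈ range #S | H.Adj x (f (rot #S r (#S - 1)))}
    have u3 := card_union_le {r ∈ range #S | H.Adj x (f (rot #S r 0))}
        {r ∈ range #S | H.Adj x (f (rot #S r (min 1 (#S - 1))))}
    rw [card_range] at this
    omega
  have hg := hf.rotate hr
  set g := fun i => f (rot #S r i) with hgdef
  change ¬ H.Adj x (g _) at h0 h1 h2 h3
  refine ⟨fun i => if i < #S then g i else x, ?_, ?_, ?_⟩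
  · intro i hi
    rw [card_insert_of_notMem hx] at hi
    split_ifs with h
    · exact mem_insert_of_mem (hg.mem i h)
    · exact mem_insert_self _ _
  · intro i j hij hj
    rw [card_insert_of_notMem hx] at hj
    rw [if_pos (show i < #S by omega)]
    split_ifs with h
    · exact hg.ne i j hij h
    · exact fun h' => hx (h' ▸ hg.mem i (by omega))
  · intro i j hij hj hn
    rw [card_insert_of_notMem hx] at hj hn
    rw [if_pos (show i < #S by omega)]
    split_ifs with h
    · exact hg.not_adj i j hij h (by omega)
    · intro h'
      have h' := h'.symm
      have hi : i = 0 ∨ i = min 1 (#S - 1) ∨ i = #S - 1 ∨ i = #S - 2 := by omega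
      rcases hi with rfl | rfl | rfl | rfl <;> tauto

lemma Packs.of_erase (h : Packs H (S.erase x)) (hx : x ∈ S) (hd : 4 * deg H S x + 2 ≤ #S) :
    Packs H S := by
  rw [← insert_erase hx]
  refine h.insert_vertex (notMem_erase x S) ?_
  rw [deg_erase_self, card_erase_of_mem hx]
  omega

/-- Distinct indices at cyclic distance at most two modulo `m`. -/
def Near (m i j : ℕ) : Prop := i ≠ j ∧ ((i ≤ j + 2 ∧ j ≤ i + 2) ∨ m + i ≤ j + 2 ∨ m + j ≤ i + 2)

lemma IsPacking.not_adj_of_near {f : ℕ → V} (hf : IsPacking H S f) {i j : ℕ} (hi : i < #S)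
    (hj : j < #S) (h : Near #S i j) : ¬ H.Adj (f i) (f j) := by
  unfold Near at h
  rcases lt_or_gt_of_ne h.1 with h' | h'
  · exact hf.not_adj i j h' hj (by omega)
  · exact fun hA => hf.not_adj j i h' hi (by omega) hA.symm

lemma card_near_le (m q : ℕ) (hq : q < m) : #{i ∈ range m | Near m i q} ≤ 4 := by
  have : {i ∈ range m | Near m i q} ⊆ {rot m 1 q, rot m 2 q, rot m (m - 1) q, rot m (m - 2) q} := by
    intro i hi
    rw [mem_filter, mem_range] at hi
    obtain ⟨hi, h1, h2⟩ := hi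
    simp only [mem_insert, mem_singleton]
    unfold rot
    split_ifs <;> omega
  exact (card_le_card this).trans card_le_four

lemma deg_deleteIncidenceSet (hy : y ≠ x) :
    deg (H.deleteIncidenceSet x) S y = deg H (S.erase x) y := by
  unfold deg
  congr 1
  ext z
  simp only [mem_filter, mem_erase, SimpleGraph.deleteIncidenceSet_adj]
  tauto

lemma deg_deleteIncidenceSet_self : deg (H.deleteIncidenceSet x) S x = 0 := by
  simp [deg, SimpleGraph.deleteIncidenceSet_adj]

lemma vol_deleteIncidenceSet (hx : x ∈ S) :
    vol H S = vol (H.deleteIncidenceSet x) S + 2 * deg H S x := by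
  rw [vol_erase hx]
  congr 1
  unfold vol
  rw [← add_sum_erase _ _ hx, deg_deleteIncidenceSet_self, zero_add]
  exact sum_congr rfl fun y hy => (deg_deleteIncidenceSet (ne_of_mem_erase hy)).symm

lemma deg_deleteIncidenceSet_le (y : V) : deg (H.deleteIncidenceSet x) S y ≤ deg H S y :=
  card_le_card fun z => by
    simp only [mem_filter, SimpleGraph.deleteIncidenceSet_adj]
    tauto

/-- Isolated vertices of `S` let us ignore the edges at `x`: if `x` is placed badly, exchange it
with an isolated vertex. -/
lemma Packs.of_deleteIncidenceSet (h : Packs (H.deleteIncidenceSet x) S) (hx : x ∈ S)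
    (hd : 4 * deg H S x + #(nonisolated H S) ≤ #S) : Packs H S := by
  obtain ⟨f, hf⟩ := h
  obtain ⟨p, hp, hpx⟩ := hf.surj hx
  have hne : ∀ i < #S, i ≠ p → f i ≠ x := fun i hi hip h =>
    hip (hf.injOn i hi p hp (h.trans hpx.symm))
  have key : ∀ i j, i < #S → j < #S → i ≠ p → j ≠ p → Near #S i j → ¬ H.Adj (f i) (f j) := by
    intro i j hi hj hip hjp hn hA
    exact hf.not_adj_of_near hi hj hn
      (SimpleGraph.deleteIncidenceSet_adj.2 ⟨hA, hne i hi hip, hne j hj hjp⟩)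
  set N := {q ∈ range #S | H.Adj x (f q)} with hN
  set W := N.biUnion fun q => {i ∈ range #S | Near #S i q} with hW
  have hNc : #N ≤ deg H S x := by
    refine card_le_card_of_injOn f (fun q hq => ?_) fun q hq r hr h => ?_
    · rw [mem_coe, hN, mem_filter, mem_range] at hq
      rw [mem_coe, mem_filter]
      exact ⟨hf.mem q hq.1, hq.2⟩
    · rw [mem_coe, hN, mem_filter, mem_range] at hq hr
      exact hf.injOn q hq.1 r hr.1 h
  have hWc : #W ≤ #N * 4 := card_biUnion_le_card_mul _ _ _ fun q hq =>
    card_near_le _ _ (mem_range.1 (mem_filter.1 hq).1)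
  have hWn : ∀ s < #S, s ∉ W → ∀ i < #S, Near #S s i → ¬ H.Adj x (f i) := by
    intro s hs hsW i hi hn hA
    exact hsW (mem_biUnion.2 ⟨i, mem_filter.2 ⟨mem_range.2 hi, hA⟩,
      mem_filter.2 ⟨mem_range.2 hs, hn⟩⟩)
  by_cases hpW : p ∈ W
  · set J := {s ∈ range #S | f s ∉ nonisolated H S} with hJ
    have hJc : #S - #(nonisolated H S) ≤ #J := by
      rw [← card_sdiff_of_subset nonisolated_subset]
      refine (card_le_card (t := J.image f) fun z hz => ?_).trans card_image_le
      rw [mem_sdiff] at hz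
      obtain ⟨s, hs, rfl⟩ := hf.surj hz.1
      exact mem_image_of_mem _ (mem_filter.2 ⟨mem_range.2 hs, hz.2⟩)
    have hpJ : p ∉ J := by
      obtain ⟨q, hq, -⟩ := mem_biUnion.1 hpW
      rw [hN, mem_filter, mem_range] at hq
      simp only [hJ, mem_filter, not_and, not_not]
      intro _
      rw [hpx, mem_nonisolated]
      exact ⟨hx, deg_pos_iff.2 ⟨f q, hf.mem q hq.1, hq.2⟩⟩
    obtain ⟨s, hsJ, hsW⟩ : ∃ s ∈ J, s ∉ W := by
      by_contra! hcon
      have : J ⊆ W.erase p := fun s hs => mem_erase.2 ⟨fun h => hpJ (h ▸ hs), hcon s hs⟩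
      have := card_le_card this
      rw [card_erase_of_mem hpW] at this
      have : 0 < #W := card_pos.2 ⟨p, hpW⟩
      omega
    have hsp : s ≠ p := fun h => hpJ (h ▸ hsJ)
    rw [hJ, mem_filter, mem_range] at hsJ
    obtain ⟨hs, hsiso⟩ := hsJ
    have hiso : ∀ y ∈ S, ¬ H.Adj (f s) y := by
      intro y hy hA
      exact hsiso (mem_nonisolated.2 ⟨hf.mem s hs, deg_pos_iff.2 ⟨y, hy, hA⟩⟩)
    have hlt : ∀ i < #S, Equiv.swap p s i < #S := by
      intro i hi
      rw [Equiv.swap_apply_def]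
      split_ifs <;> assumption
    refine ⟨fun i => f (Equiv.swap p s i), fun i hi => hf.mem _ (hlt i hi), ?_, ?_⟩
    · intro i j hij hj h
      have := hf.injOn _ (hlt i (by omega)) _ (hlt j hj) h
      have := (Equiv.swap p s).injective this
      omega
    · intro i j hij hj hn
      have hi : i < #S := by omega
      have hn1 : Near #S i j := by unfold Near; omega
      have hn2 : Near #S j i := by unfold Near; omega
      rw [Equiv.swap_apply_def, Equiv.swap_apply_def]
      split_ifs with h1 h2 h3 h4 h5 h6 h7
      · omega
      · exact hiso _ (by rw [hpx]; exact hx)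
      · exact hiso _ (hf.mem j hj)
      · exact fun h => hiso _ (by rw [hpx]; exact hx) h.symm
      · omega
      · rw [hpx]; rw [h4] at hn1; exact hWn s hs hsW j hj hn1
      · exact fun h => hiso _ (hf.mem i hi) h.symm
      · rw [hpx]; rw [‹j = s›] at hn2; exact fun h => hWn s hs hsW i hi hn2 h.symm
      · exact key i j hi hj h1 ‹¬j = p› hn1
  · refine ⟨f, hf.mem, hf.ne, fun i j hij hj hn => ?_⟩
    have hn1 : Near #S i j := by unfold Near; omega
    have hn2 : Near #S j i := by unfold Near; omega
    by_cases hi : i = p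
    · rw [hi, hpx]; rw [hi] at hn1; exact hWn p hp hpW j hj hn1
    by_cases hj' : j = p
    · rw [hj', hpx]; rw [hj'] at hn2; exact fun h => hWn p hp hpW i (by omega) hn2 h.symm
    exact key i j (by omega) hj hi hj' hn1

/-- A packing of `A` whose last two elements are isolated in `S`. -/
def TailPacks (H : SimpleGraph V) (S A : Finset V) : Prop :=
  ∃ f, IsPacking H A f ∧ ∀ i < #A, #A ≤ i + 2 → deg H S (f i) = 0

lemma not_adj_of_deg_eq_zero (h : deg H S x = 0) (hy : y ∈ S) : ¬ H.Adj x y := fun hA =>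
  (deg_pos_iff.2 ⟨y, hy, hA⟩).ne' h

lemma TailPacks.union {A B : Finset V} (hA : TailPacks H S A) (hB : TailPacks H S B)
    (hAS : A ⊆ S) (hBS : B ⊆ S) (hAB : Disjoint A B) : TailPacks H S (A ∪ B) := by
  obtain ⟨f, hf, hf0⟩ := hA
  obtain ⟨g, hg, hg0⟩ := hB
  have hc : #(A ∪ B) = #A + #B := card_union_of_disjoint hAB
  refine ⟨fun i => if i < #A then f i else g (i - #A), ⟨?_, ?_, ?_⟩, ?_⟩
  · intro i hi
    split_ifs with h
    · exact mem_union_left _ (hf.mem i h)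
    · exact mem_union_right _ (hg.mem _ (by omega))
  · intro i j hij hj
    split_ifs with h1 h2 h2
    · exact hf.ne i j hij h2
    · exact fun h => disjoint_left.1 hAB (hf.mem i h1) (h ▸ hg.mem _ (by omega))
    · omega
    · exact hg.ne _ _ (by omega) (by omega)
  · intro i j hij hj hn
    rw [hc] at hj hn
    split_ifs with h1 h2 h2
    · exact hf.not_adj i j hij h2 (by omega)
    · by_cases hi : #A ≤ i + 2
      · exact not_adj_of_deg_eq_zero (hf0 i h1 hi) (hBS (hg.mem _ (by omega)))
      · exact fun h => not_adj_of_deg_eq_zero (hg0 (j - #A) (by omega) (by omega))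
          (hAS (hf.mem i h1)) h.symm
    · omega
    · exact hg.not_adj _ _ (by omega) (by omega) (by omega)
  · intro i hi hi2
    dsimp only
    split_ifs with h
    · exact hf0 i h (by omega)
    · exact hg0 _ (by omega) (by omega)

lemma exists_enum (C : Finset V) [Nonempty V] : ∃ c : ℕ → V, (∀ i < #C, c i ∈ C) ∧
    ∀ i j, i < j → j < #C → c i ≠ c j := by
  refine ⟨fun i => if h : i < #C then C.equivFin.symm ⟨i, h⟩ else Classical.arbitrary V, ?_, ?_⟩
  · intro i hi
    dsimp only
    rw [dif_pos hi]
    exact coe_mem _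
  · intro i j hij hj h
    dsimp only at h
    rw [dif_pos (hij.trans hj), dif_pos hj] at h
    have := C.equivFin.symm.injective (Subtype.ext h)
    simp only [Fin.mk.injEq] at this
    omega

lemma tailPacks_of_independent {C : Finset V} {z w : V} (hC : ∀ x ∈ C, ∀ y ∈ C, ¬ H.Adj x y)
    (hCS : C ⊆ S) (hz : deg H S z = 0) (hw : deg H S w = 0) (hzC : z ∉ C) (hwC : w ∉ C)
    (hwS : w ∈ S) (hzw : z ≠ w) : TailPacks H S (C ∪ {z, w}) := by
  have : Nonempty V := ⟨z⟩
  obtain ⟨c, hc, hcn⟩ := exists_enum C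
  have hcard : #(C ∪ {z, w}) = #C + 2 := by
    rw [card_union_of_disjoint, card_pair hzw]
    simp [hzC, hwC]
  refine ⟨fun i => if i < #C then c i else if i = #C then z else w, ⟨?_, ?_, ?_⟩, ?_⟩
  · intro i hi
    split_ifs with h h'
    · exact mem_union_left _ (hc i h)
    · simp
    · simp
  · intro i j hij hj
    split_ifs with h1 h2 h3 h4 h5 h6 h7 <;> first | omega | skip
    · exact hcn i j hij h2
    · exact fun h => hzC (h ▸ hc i h1)
    · exact fun h => hwC (h ▸ hc i h1)
  · intro i j hij hj _
    split_ifs with h1 h2 h3 h4 h5 h6 h7 <;> first | omega | skip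
    · exact hC _ (hc i h1) _ (hc j h2)
    · exact fun h => not_adj_of_deg_eq_zero hz (hCS (hc i h1)) h.symm
    · exact fun h => not_adj_of_deg_eq_zero hw (hCS (hc i h1)) h.symm
    · exact not_adj_of_deg_eq_zero hz hwS
  · intro i hi hi2
    dsimp only
    rw [if_neg (by omega)]
    split_ifs
    · exact hz
    · exact hw

/-- `T` splits into `p` independent sets. -/
def Splits (H : SimpleGraph V) (T : Finset V) (p : ℕ) : Prop :=
  ∃ c : V → ℕ, (∀ x ∈ T, c x < p) ∧ ∀ x ∈ T, ∀ y ∈ T, H.Adj x y → c x ≠ c y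

lemma splits_empty : Splits H ∅ 0 := ⟨fun _ => 0, by simp, by simp⟩

lemma Splits.union {p : ℕ} {C : Finset V} (h : Splits H T p)
    (hC : ∀ x ∈ C, ∀ y ∈ C, ¬ H.Adj x y) : Splits H (C ∪ T) (p + 1) := by
  obtain ⟨c, hc, hcn⟩ := h
  have hT : ∀ x ∈ C ∪ T, x ∉ C → x ∈ T := fun x hx h => (mem_union.1 hx).resolve_left h
  refine ⟨fun x => if x ∈ C then p else c x, fun x hx => ?_, fun x hx y hy hA => ?_⟩ <;> dsimp only
  · split_ifs with h
    · omega
    · have := hc x (hT x hx h); omega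
  · split_ifs with h1 h2 h2
    · exact (hC x h1 y h2 hA).elim
    · exact (hc y (hT y hy h2)).ne'
    · exact (hc x (hT x hx h1)).ne
    · exact hcn x (hT x hx h1) y (hT y hy h2) hA

lemma splits_card (T : Finset V) : Splits H T #T := by
  induction T using Finset.induction_on with
  | empty => exact splits_empty
  | insert x T hx ih =>
    rw [card_insert_of_notMem hx, insert_eq]
    exact ih.union (by simp)

lemma Packs.of_subset {U : Finset V} (h : Packs H U) (hUS : U ⊆ S)
    (hd : ∀ x ∈ S, x ∉ U → 4 * deg H S x < #U) : Packs H S := by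
  have : ∀ W ⊆ S \ U, Packs H (U ∪ W) := by
    intro W
    induction W using Finset.induction_on with
    | empty => intro _; simpa using h
    | insert x W hx ih =>
      intro hW
      rw [insert_subset_iff, mem_sdiff] at hW
      rw [union_insert]
      refine (ih hW.2).insert_vertex (by simp [hx, hW.1.2]) ?_
      have h0 := hd x hW.1.1 hW.1.2
      have h1 : deg H (U ∪ W) x ≤ deg H S x :=
        deg_mono (union_subset hUS (hW.2.trans sdiff_subset)) x
      have h2 : #U ≤ #(U ∪ W) := card_le_card subset_union_left
      omega
  have := this _ subset_rfl
  rwa [union_sdiff_of_subset hUS] at this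

lemma packs_of_independent (hS : S.Nonempty) (h : ∀ x ∈ S, deg H S x = 0) : Packs H S := by
  have := hS.to_type
  obtain ⟨c, hc, hcn⟩ := exists_enum S
  exact ⟨c, hc, hcn, fun i j hij hj _ =>
    not_adj_of_deg_eq_zero (h _ (hc i (hij.trans hj))) (hc j hj)⟩

/-- If the non-isolated vertices split into `p` independent sets and there are at least `2 * p`
isolated ones, put each independent set in a block followed by two isolated vertices. -/
lemma Splits.packs {p : ℕ} (h : Splits H (nonisolated H S) p) (hS : S.Nonempty)
    (hp : 2 * p + #(nonisolated H S) ≤ #S) : Packs H S := by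
  have := hS.to_type
  obtain ⟨c, hc, hcn⟩ := h
  have hstep : ∀ q, ∀ Z ⊆ S \ nonisolated H S, #Z = 2 * q →
      TailPacks H S ({x ∈ nonisolated H S | c x < q} ∪ Z) := by
    intro q
    induction q with
    | zero =>
      intro Z _ hZ
      obtain rfl : Z = ∅ := card_eq_zero.1 (by omega)
      exact ⟨fun _ => hS.choose, ⟨by simp, by simp, by simp⟩, by simp⟩
    | succ q ih =>
      intro Z hZS hZ
      obtain ⟨z, hz⟩ : Z.Nonempty := card_pos.1 (by omega)
      have hZe : #(Z.erase z) = 2 * q + 1 := by rw [card_erase_of_mem hz]; omega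
      obtain ⟨w, hw⟩ : (Z.erase z).Nonempty := card_pos.1 (by omega)
      have hZe2 : #((Z.erase z).erase w) = 2 * q := by rw [card_erase_of_mem hw]; omega
      have hsub : (Z.erase z).erase w ⊆ S \ nonisolated H S :=
        ((erase_subset _ _).trans (erase_subset _ _)).trans hZS
      have h1 := ih _ hsub hZe2
      have hwZ := mem_of_mem_erase hw
      have hiso : ∀ u ∈ Z, deg H S u = 0 ∧ u ∈ S ∧ u ∉ nonisolated H S := by
        intro u hu
        have := mem_sdiff.1 (hZS hu)
        refine ⟨?_, this.1, this.2⟩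
        by_contra h0
        exact this.2 (mem_nonisolated.2 ⟨this.1, by omega⟩)
      have h2 : TailPacks H S ({x ∈ nonisolated H S | c x = q} ∪ {z, w}) := by
        refine tailPacks_of_independent ?_ ((filter_subset _ _).trans nonisolated_subset)
          (hiso z hz).1 (hiso w hwZ).1 ?_ ?_ (hiso w hwZ).2.1 (ne_of_mem_erase hw).symm
        · intro x hx y hy hA
          rw [mem_filter] at hx hy
          exact hcn x hx.1 y hy.1 hA (hx.2.trans hy.2.symm)
        · simp [(hiso z hz).2.2]
        · simp [(hiso w hwZ).2.2]
      have h3 := h1.union h2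
        (union_subset ((filter_subset _ _).trans nonisolated_subset) (hsub.trans sdiff_subset))
        (union_subset ((filter_subset _ _).trans nonisolated_subset) ?_) ?_
      · convert h3 using 1
        ext u
        simp only [mem_union, mem_filter, mem_erase, mem_insert, mem_singleton]
        constructor
        · rintro (⟨h, hu⟩ | hu)
          · by_cases u = z <;> by_cases u = w <;> (have : c u < q ∨ c u = q := by omega) <;> tauto
          · tauto
        · rintro ((⟨h, hu⟩ | ⟨_, _, hu⟩) | (⟨h, hu⟩ | rfl | rfl))
          · exact Or.inl ⟨h, by omega⟩
          · exact Or.inr hu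
          · exact Or.inl ⟨h, by omega⟩
          · exact Or.inr hz
          · exact Or.inr hwZ
      · intro u hu
        rw [mem_insert, mem_singleton] at hu
        rcases hu with rfl | rfl
        · exact (hiso _ hz).2.1
        · exact (hiso _ hwZ).2.1
      · rw [disjoint_left]
        intro u hu hu'
        have hzn := (hiso z hz).2.2
        have hwn := (hiso w hwZ).2.2
        simp only [mem_union, mem_filter, mem_erase, mem_insert, mem_singleton] at hu hu'
        rcases hu with ⟨h, hu⟩ | ⟨h1, h2, hu⟩
        · rcases hu' with ⟨_, h'⟩ | rfl | rfl
          · omega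
          · exact hzn h
          · exact hwn h
        · rcases hu' with ⟨h, _⟩ | rfl | rfl
          · exact (hiso u hu).2.2 h
          · exact h2 rfl
          · exact h1 rfl
  obtain ⟨Z, hZ, hZc⟩ := exists_subset_card_eq (s := S \ nonisolated H S) (n := 2 * p)
    (by rw [card_sdiff_of_subset nonisolated_subset]; omega)
  obtain ⟨f, hf, -⟩ := hstep p Z hZ hZc
  rcases Nat.eq_zero_or_pos p with rfl | hp0
  · refine packs_of_independent hS fun x hx => ?_
    by_contra h0
    have := hc x (mem_nonisolated.2 ⟨hx, by omega⟩)
    omega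
  · refine Packs.of_subset ⟨f, hf⟩ (union_subset ((filter_subset _ _).trans nonisolated_subset)
      (hZ.trans sdiff_subset)) fun x hx hxn => ?_
    suffices deg H S x = 0 by
      have : 0 < #({x ∈ nonisolated H S | c x < p} ∪ Z) :=
        card_pos.2 ((card_pos.1 (by omega : 0 < #Z)).mono subset_union_right)
      omega
    · by_contra h0
      have hx' : x ∈ nonisolated H S := mem_nonisolated.2 ⟨hx, by omega⟩
      exact hxn (mem_union_left _ (mem_filter.2 ⟨hx', hc x hx'⟩))

lemma Packs.of_star {J : Finset V} {v : V} (hv : v ∈ S)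
    (hJ : ∀ x ∈ J, x ∈ S ∧ H.Adj v x ∧ deg H S x = 1) (hd : 4 * deg H S v + 2 ≤ #S + 3 * #J)
    (hS : 6 + #J ≤ #S) (h : Packs H (S.erase v \ J)) : Packs H S := by
  have hJS : J ⊆ S.erase v := fun x hx => mem_erase.2 ⟨(hJ x hx).2.1.ne', (hJ x hx).1⟩
  have hvU : v ∉ S.erase v \ J := by simp
  have hc : #(S.erase v \ J) = #S - 1 - #J := by
    rw [card_sdiff_of_subset hJS, card_erase_of_mem hv]
  have hdeg : deg H (S.erase v \ J) v + #J ≤ deg H S v := by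
    unfold deg
    rw [← card_union_of_disjoint (s := {y ∈ S.erase v \ J | H.Adj v y}) (t := J)
      (disjoint_left.2 fun a ha => by simp only [mem_filter, mem_sdiff] at ha; tauto)]
    refine card_le_card fun a ha => ?_
    simp only [mem_union, mem_filter, mem_sdiff, mem_erase] at ha ⊢
    rcases ha with ha | ha
    · tauto
    · exact ⟨(hJ a ha).1, (hJ a ha).2.1⟩
  have h1 := h.insert_vertex hvU (by omega)
  refine h1.of_subset (insert_subset_iff.2 ⟨hv, sdiff_subset.trans (erase_subset _ _)⟩) ?_
  intro x hx hxn
  have hxJ : x ∈ J := by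
    by_contra hxJ
    refine hxn (mem_insert.2 ?_)
    by_cases hxv : x = v
    · exact Or.inl hxv
    · exact Or.inr (mem_sdiff.2 ⟨mem_erase.2 ⟨hxv, hx⟩, hxJ⟩)
  rw [(hJ x hxJ).2.2, card_insert_of_notMem hvU]
  omega

lemma vol_union {A B : Finset V} (h : Disjoint A B) :
    vol H A + 2 * ∑ b ∈ B, deg H A b ≤ vol H (A ∪ B) := by
  induction B using Finset.induction_on with
  | empty => simp
  | insert x B hx ih =>
    rw [disjoint_insert_right] at h
    have := ih h.2
    rw [union_insert, vol_insert (by simp [hx, h.1]), sum_insert hx]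
    have : deg H A x ≤ deg H (A ∪ B) x := deg_mono subset_union_left x
    omega

lemma vol_eq_nonisolated_sum : vol H S = ∑ x ∈ nonisolated H S, deg H S x := by
  unfold vol nonisolated
  rw [sum_filter]
  exact sum_congr rfl fun x _ => by split_ifs <;> omega

/-- The vertices of `S` other than `v` that are not adjacent to `v`. -/
noncomputable def nonNbrs (H : SimpleGraph V) (S : Finset V) (v : V) : Finset V :=
  {x ∈ S.erase v | ¬ H.Adj v x}

lemma mem_nonNbrs {v : V} : x ∈ nonNbrs H S v ↔ x ≠ v ∧ x ∈ S ∧ ¬ H.Adj v x := by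
  simp [nonNbrs, and_assoc]

lemma card_nonNbrs {v : V} (hv : v ∈ S) : #(nonNbrs H S v) + deg H S v + 1 = #S := by
  rw [← deg_erase_self, nonNbrs, deg, add_comm #_, card_filter_add_card_filter_not,
    card_erase_add_one hv]

lemma sum_nonNbrs {v : V} (hv : v ∈ S) :
    ∑ x ∈ nonNbrs H S v, deg H S x + 2 * deg H S v ≤ vol H S := by
  unfold vol
  rw [← add_sum_erase S _ hv, ← sum_filter_add_sum_filter_not (S.erase v) (H.Adj v ·)]
  have : deg H S v ≤ ∑ x ∈ S.erase v with H.Adj v x, deg H S x := by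
    calc deg H S v = #{x ∈ S.erase v | H.Adj v x} := by rw [← deg_erase_self, deg]
      _ ≤ _ := by
        rw [card_eq_sum_ones]
        refine sum_le_sum fun x hx => ?_
        exact deg_pos_iff.2 ⟨v, hv, (mem_filter.1 hx).2.symm⟩
  have e : ∑ x ∈ nonNbrs H S v, deg H S x = ∑ x ∈ S.erase v with ¬ H.Adj v x, deg H S x := rfl
  omega

lemma ne_of_card_four {a b c d : V} (h : #{a, b, c, d} = 4) :
    a ≠ b ∧ a ≠ c ∧ a ≠ d ∧ b ≠ c ∧ b ≠ d ∧ c ≠ d := by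
  refine ⟨?_, ?_, ?_, ?_, ?_, ?_⟩ <;> rintro rfl
  · have := card_le_three (a := a) (b := c) (c := d); simp at h; omega
  · have := card_le_three (a := b) (b := a) (c := d); simp at h; omega
  · have := card_le_three (a := b) (b := c) (c := a); simp at h; omega
  · have := card_le_three (a := a) (b := b) (c := d); simp at h; omega
  · have := card_le_three (a := a) (b := c) (c := b); simp at h; omega
  · have := card_le_three (a := a) (b := b) (c := c); simp at h; omega

/-- Insert the block `b₁, b₂, v, b₃, b₄` at a suitable place of a packing. -/
lemma Packs.insert_block {v b₁ b₂ b₃ b₄ : V} (h : Packs H T) (hv : v ∉ T) (h₁ : b₁ ∉ T)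
    (h₂ : b₂ ∉ T) (h₃ : b₃ ∉ T) (h₄ : b₄ ∉ T) (hB : #{b₁, b₂, b₃, b₄} = 4)
    (hvB : v ∉ ({b₁, b₂, b₃, b₄} : Finset V))
    (hvn : ∀ b ∈ ({b₁, b₂, b₃, b₄} : Finset V), ¬ H.Adj v b)
    (h₁₂ : ¬ H.Adj b₁ b₂) (h₂₃ : ¬ H.Adj b₂ b₃) (h₃₄ : ¬ H.Adj b₃ b₄)
    (hd : 2 * (deg H T b₁ + deg H T b₂ + deg H T b₃ + deg H T b₄) < #T) (hT : 2 ≤ #T) :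
    Packs H (T ∪ insert v {b₁, b₂, b₃, b₄}) := by
  obtain ⟨f, hf⟩ := h
  obtain ⟨r, hr, c1, c2, c3, c4, c5, c6⟩ : ∃ r < #T, ¬ H.Adj b₁ (f (rot #T r (#T - 1))) ∧
      ¬ H.Adj b₁ (f (rot #T r (#T - 2))) ∧ ¬ H.Adj b₂ (f (rot #T r (#T - 1))) ∧
      ¬ H.Adj b₃ (f (rot #T r 0)) ∧ ¬ H.Adj b₄ (f (rot #T r 0)) ∧
      ¬ H.Adj b₄ (f (rot #T r 1)) := by
    by_contra! hcon
    set R : V → ℕ → Finset ℕ := fun b i => {r ∈ range #T | H.Adj b (f (rot #T r i))} with hR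
    have hsub : range #T ⊆ ((R b₁ (#T - 1) ∪ R b₁ (#T - 2)) ∪ (R b₂ (#T - 1) ∪ R b₃ 0)) ∪
        (R b₄ 0 ∪ R b₄ 1) := by
      intro r hr
      have := hcon r (mem_range.1 hr)
      simp only [hR, mem_union, mem_filter, hr, true_and]
      tauto
    have e0 := card_le_card hsub
    have e (b : V) (i : ℕ) (hi : i < #T) : #(R b i) ≤ deg H T b := hf.card_rot_le b hi
    have e1 := e b₁ (#T - 1) (by omega)
    have e2 := e b₁ (#T - 2) (by omega)
    have e3 := e b₂ (#T - 1) (by omega)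
    have e4 := e b₃ 0 (by omega)
    have e5 := e b₄ 0 (by omega)
    have e6 := e b₄ 1 (by omega)
    have u1 := card_union_le ((R b₁ (#T - 1) ∪ R b₁ (#T - 2)) ∪ (R b₂ (#T - 1) ∪ R b₃ 0))
        (R b₄ 0 ∪ R b₄ 1)
    have u2 := card_union_le (R b₁ (#T - 1) ∪ R b₁ (#T - 2)) (R b₂ (#T - 1) ∪ R b₃ 0)
    have u3 := card_union_le (R b₁ (#T - 1)) (R b₁ (#T - 2))
    have u4 := card_union_le (R b₂ (#T - 1)) (R b₃ 0)
    have u5 := card_union_le (R b₄ 0) (R b₄ 1)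
    rw [card_range] at e0
    omega
  have hg := hf.rotate hr
  set g := fun i => f (rot #T r i) with hgdef
  change ¬ H.Adj _ (g _) at c1 c2 c3 c4 c5 c6
  have hcard : #(T ∪ insert v {b₁, b₂, b₃, b₄}) = #T + 5 := by
    rw [card_union_of_disjoint, card_insert_of_notMem hvB, hB]
    simp [hv, h₁, h₂, h₃, h₄]
  obtain ⟨n12, n13, n14, n23, n24, n34⟩ := ne_of_card_four hB
  simp only [mem_insert, mem_singleton, not_or] at hvB
  have a1 := hvn b₁ (by simp)
  have a2 := hvn b₂ (by simp)
  have a3 := hvn b₃ (by simp)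
  have a4 := hvn b₄ (by simp)
  obtain ⟨k, hk0, hk1, hk2, hk3, hk4⟩ : ∃ k : ℕ → V, k 0 = b₁ ∧ k 1 = b₂ ∧ k 2 = v ∧ k 3 = b₃ ∧
      k 4 = b₄ := ⟨fun i => if i = 0 then b₁ else if i = 1 then b₂ else if i = 2 then v else
        if i = 3 then b₃ else b₄, by simp⟩
  have five : ∀ i < 5, i = 0 ∨ i = 1 ∨ i = 2 ∨ i = 3 ∨ i = 4 := by omega
  have hkT : ∀ i < 5, k i ∉ T := by
    intro i hi
    rcases five i hi with rfl | rfl | rfl | rfl | rfl <;> simp [*]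
  refine ⟨fun i => if i < #T then g i else k (i - #T), fun i hi => ?_, fun i j hij hj => ?_,
    fun i j hij hj hn => ?_⟩
  · rw [hcard] at hi
    split_ifs with h
    · exact mem_union_left _ (hg.mem i h)
    · refine mem_union_right _ ?_
      rcases five (i - #T) (by omega) with h | h | h | h | h <;> simp [*]
  · rw [hcard] at hj
    split_ifs with h h' h'
    · exact hg.ne i j hij h'
    · exact fun e => hkT (j - #T) (by omega) (e ▸ hg.mem i h)
    · omega
    · obtain ⟨p, hp⟩ : ∃ p, p = i - #T := ⟨_, rfl⟩
      obtain ⟨q, hq⟩ : ∃ q, q = j - #T := ⟨_, rfl⟩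
      rw [← hp, ← hq]
      rcases five p (by omega) with rfl | rfl | rfl | rfl | rfl <;>
        rcases five q (by omega) with rfl | rfl | rfl | rfl | rfl <;>
        first | omega | (simp only [hk0, hk1, hk2, hk3, hk4]; tauto)
  · rw [hcard] at hj hn
    split_ifs with h h' h'
    · exact hg.not_adj i j hij h' (by omega)
    · intro e
      have e := e.symm
      obtain ⟨q, hq⟩ : ∃ q, q = j - #T := ⟨_, rfl⟩
      rw [← hq] at e
      have hi : (q = 0 ∧ (i = #T - 1 ∨ i = #T - 2)) ∨ (q = 1 ∧ i = #T - 1) ∨ (q = 3 ∧ i = 0) ∨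
          (q = 4 ∧ (i = 0 ∨ i = 1)) := by omega
      rcases hi with ⟨rfl, rfl | rfl⟩ | ⟨rfl, rfl⟩ | ⟨rfl, rfl⟩ | ⟨rfl, rfl | rfl⟩ <;>
        simp only [hk0, hk1, hk3, hk4] at e <;> tauto
    · omega
    · obtain ⟨p, hp⟩ : ∃ p, p = i - #T := ⟨_, rfl⟩
      obtain ⟨q, hq⟩ : ∃ q, q = j - #T := ⟨_, rfl⟩
      rw [← hp, ← hq]
      have a1' := fun e : H.Adj b₁ v => a1 e.symm
      have a2' := fun e : H.Adj b₂ v => a2 e.symm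
      rcases five p (by omega) with rfl | rfl | rfl | rfl | rfl <;>
        rcases five q (by omega) with rfl | rfl | rfl | rfl | rfl <;>
        first | omega | (simp only [hk0, hk1, hk2, hk3, hk4]; assumption)

/-- `B` is traversed by a path on four vertices in the complement of `H`. -/
def HasCoPath (H : SimpleGraph V) (B : Finset V) : Prop :=
  ∃ a b c d, B = {a, b, c, d} ∧ ¬ H.Adj a b ∧ ¬ H.Adj b c ∧ ¬ H.Adj c d

/-- A triangle of `H` together with one more vertex. -/
def HasTriangle (H : SimpleGraph V) (B : Finset V) : Prop :=
  ∃ a b c d, B = {a, b, c, d} ∧ H.Adj a b ∧ H.Adj b c ∧ H.Adj a c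

/-- A claw of `H`. -/
def HasClaw (H : SimpleGraph V) (B : Finset V) : Prop :=
  ∃ a b c d, B = {a, b, c, d} ∧ H.Adj a b ∧ H.Adj a c ∧ H.Adj a d

lemma Packs.of_block {v : V} {B : Finset V} (hv : v ∈ S) (hB : B ⊆ nonNbrs H S v) (hB4 : #B = 4)
    (hp : HasCoPath H B) (h : Packs H (S.erase v \ B))
    (hd : 2 * ∑ b ∈ B, deg H (S.erase v \ B) b + 5 < #S) (hS : 7 ≤ #S) : Packs H S := by
  obtain ⟨a, b, c, d, rfl, hab, hbc, hcd⟩ := hp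
  obtain ⟨n1, n2, n3, n4, n5, n6⟩ := ne_of_card_four hB4
  have hmem := fun x hx => mem_nonNbrs.1 (hB hx : x ∈ _)
  have hBS : {a, b, c, d} ⊆ S.erase v := fun x hx =>
    mem_erase.2 ⟨(hmem x hx).1, (hmem x hx).2.1⟩
  have hvB : v ∉ ({a, b, c, d} : Finset V) := fun h => (hmem v h).1 rfl
  have hc : #(S.erase v \ {a, b, c, d}) + 5 = #S := by
    rw [card_sdiff_of_subset hBS, hB4, card_erase_of_mem hv]; omega
  have hsum : ∑ u ∈ {a, b, c, d}, deg H (S.erase v \ {a, b, c, d}) u =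
      deg H (S.erase v \ {a, b, c, d}) a + deg H (S.erase v \ {a, b, c, d}) b +
      deg H (S.erase v \ {a, b, c, d}) c + deg H (S.erase v \ {a, b, c, d}) d := by
    rw [sum_insert (by simp [n1, n2, n3]), sum_insert (by simp [n4, n5]),
      sum_insert (by simp [n6]), sum_singleton]
    ring
  have := h.insert_block (v := v) (b₁ := a) (b₂ := b) (b₃ := c) (b₄ := d) (by simp) (by simp)
    (by simp) (by simp) (by simp) hB4 hvB (fun b hb => (hmem b hb).2.2) hab hbc hcd
    (by omega) (by omega)
  rwa [union_insert, sdiff_union_of_subset hBS, insert_erase hv] at this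

lemma vol_block {v : V} {B : Finset V} (hv : v ∈ S) (hB : B ⊆ nonNbrs H S v) :
    vol H (S.erase v \ B) + 2 * ∑ b ∈ B, deg H (S.erase v \ B) b + 2 * deg H S v ≤ vol H S := by
  rw [vol_erase hv]
  have := vol_union (H := H) (sdiff_disjoint (s := B) (t := S.erase v))
  rw [sdiff_union_of_subset (hB.trans (filter_subset _ _))] at this
  omega

lemma card_block {v : V} {B : Finset V} (hv : v ∈ S) (hB : B ⊆ nonNbrs H S v) :
    #(S.erase v \ B) + #B + 1 = #S := by
  rw [card_sdiff_add_card_eq_card (hB.trans (filter_subset _ _)), card_erase_add_one hv]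

lemma vol_four {a b c d : V} (h : #{a, b, c, d} = 4) : vol H {a, b, c, d} =
    2 * ((if H.Adj a b then 1 else 0) + (if H.Adj a c then 1 else 0) +
      (if H.Adj a d then 1 else 0) + (if H.Adj b c then 1 else 0) +
      (if H.Adj b d then 1 else 0) + (if H.Adj c d then 1 else 0)) := by
  obtain ⟨n1, n2, n3, n4, n5, n6⟩ := ne_of_card_four h
  have h0 : ∀ x, deg H ∅ x = 0 := fun x => by simp [deg]
  have hv : vol H ∅ = 0 := by simp [vol]
  rw [vol_insert (by simp [*]), vol_insert (by simp [*]), vol_insert (by simp [*]),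
    ← insert_empty_eq d, vol_insert (by simp), deg_insert (by simp [*]), deg_insert (by simp [*]),
    deg_insert (by simp [*]), deg_insert (by simp [*]), deg_insert (by simp [*]),
    deg_insert (by simp [*]), h0, h0, h0, h0, hv]
  ring

lemma copath_or_triangle_or_claw {B : Finset V} (hB : #B = 4) (h : vol H B ≤ 6) :
    HasCoPath H B ∨ HasTriangle H B ∨ HasClaw H B := by
  obtain ⟨a, b, c, d, n1, n2, n3, n4, n5, n6, rfl⟩ := card_eq_four.1 hB
  rw [vol_four hB] at h
  by_contra! hcon
  obtain ⟨hP, hT, hC⟩ := hcon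
  obtain ⟨e, he⟩ : ∃ e : V → V → Bool, ∀ p q, e p q = true ↔ H.Adj p q :=
    ⟨fun p q => decide (H.Adj p q), by simp⟩
  have hsymm : ∀ p q, e p q = e q p := fun p q => by
    rw [Bool.eq_iff_iff, he, he, H.adj_comm]
  have P : ∀ p q r s : V, ({a, b, c, d} : Finset V) = {p, q, r, s} →
      e p q || e q r || e r s := by
    intro p q r s h
    by_contra h'
    simp only [Bool.or_eq_true, he, not_or] at h'
    exact hP ⟨p, q, r, s, h, h'.1.1, h'.1.2, h'.2⟩
  have T : ∀ p q r s : V, ({a, b, c, d} : Finset V) = {p, q, r, s} →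
      !(e p q && e q r && e p r) := by
    intro p q r s h
    by_contra h'
    simp only [Bool.not_eq_true', Bool.not_eq_false, Bool.and_eq_true, he] at h'
    exact hT ⟨p, q, r, s, h, h'.1.1, h'.1.2, h'.2⟩
  have C : ∀ p q r s : V, ({a, b, c, d} : Finset V) = {p, q, r, s} →
      !(e p q && e p r && e p s) := by
    intro p q r s h
    by_contra h'
    simp only [Bool.not_eq_true', Bool.not_eq_false, Bool.and_eq_true, he] at h'
    exact hC ⟨p, q, r, s, h, h'.1.1, h'.1.2, h'.2⟩
  simp only [← he] at h
  have sba := hsymm b a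
  have sca := hsymm c a
  have sda := hsymm d a
  have scb := hsymm c b
  have sdb := hsymm d b
  have sdc := hsymm d c
  clear hP hT hC hsymm he hB n1 n2 n3 n4 n5 n6
  have E1 : ({a, b, c, d} : Finset V) = {a, b, d, c} := by clear * -; grind
  have E2 : ({a, b, c, d} : Finset V) = {a, c, b, d} := by clear * -; grind
  have E3 : ({a, b, c, d} : Finset V) = {a, c, d, b} := by clear * -; grind
  have E4 : ({a, b, c, d} : Finset V) = {a, d, b, c} := by clear * -; grind
  have E5 : ({a, b, c, d} : Finset V) = {a, d, c, b} := by clear * -; grind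
  have E6 : ({a, b, c, d} : Finset V) = {b, a, c, d} := by clear * -; grind
  have E7 : ({a, b, c, d} : Finset V) = {b, a, d, c} := by clear * -; grind
  have E8 : ({a, b, c, d} : Finset V) = {c, a, b, d} := by clear * -; grind
  have E9 : ({a, b, c, d} : Finset V) = {c, a, d, b} := by clear * -; grind
  have E10 : ({a, b, c, d} : Finset V) = {d, a, b, c} := by clear * -; grind
  have E11 : ({a, b, c, d} : Finset V) = {d, a, c, b} := by clear * -; grind
  have E12 : ({a, b, c, d} : Finset V) = {b, c, d, a} := by clear * -; grind
  have P1 := P a b c d rfl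
  have P2 := P a b d c E1
  have P3 := P a c b d E2
  have P4 := P a c d b E3
  have P5 := P a d b c E4
  have P6 := P a d c b E5
  have P7 := P b a c d E6
  have P8 := P b a d c E7
  have P9 := P c a b d E8
  have P10 := P c a d b E9
  have P11 := P d a b c E10
  have P12 := P d a c b E11
  have T1 := T a b c d rfl
  have T2 := T a b d c E1
  have T3 := T a c d b E3
  have T4 := T b c d a E12
  have C1 := C a b c d rfl
  have C2 := C b a c d E6
  have C3 := C c a b d E8
  have C4 := C d a b c E10
  clear P T C E1 E2 E3 E4 E5 E6 E7 E8 E9 E10 E11 E12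
  simp only [sba, sca, sda, scb, sdb, sdc] at P2 P3 P4 P5 P6 P7 P8 P9 P10 P11 P12 C2 C3 C4
  exact four_vertices (e a b) (e a c) (e a d) (e b c) (e b d) (e c d)
    (by simpa [Bool.toNat, cond_eq_ite] using h)
    P1 P2 P3 P4 P5 P6 P7 P8 P9 P10 P11 P12 T1 T2 T3 T4 C1 C2 C3 C4

lemma exists_subset_card_four {A : Finset V} (f : V → ℕ) {c : ℕ} (hA : 4 ≤ #A) (hc : 4 ≤ c)
    (h : ∑ x ∈ A, f x + 8 ≤ 2 * #A + c) : ∃ B ⊆ A, #B = 4 ∧ ∑ x ∈ B, f x ≤ c := by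
  induction hn : #A using Nat.strong_induction_on generalizing A with
  | _ n ih =>
    subst hn
    rcases hA.eq_or_lt with h4 | h4
    · exact ⟨A, Subset.rfl, h4.symm, by omega⟩
    by_cases hx : ∃ x ∈ A, 2 ≤ f x
    · obtain ⟨x, hx, hfx⟩ := hx
      have h1 := add_sum_erase A f hx
      have h2 := card_erase_add_one hx
      obtain ⟨B, hB, hB'⟩ := ih #(A.erase x) (by omega) (by omega) (by omega) rfl
      exact ⟨B, hB.trans (erase_subset _ _), hB'⟩
    · push Not at hx
      obtain ⟨B, hB, hB4⟩ := exists_subset_card_eq hA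
      refine ⟨B, hB, hB4, ?_⟩
      have := sum_le_card_nsmul B f 1 fun x hxB => Nat.le_of_lt_succ (hx x (hB hxB))
      rw [hB4] at this
      exact this.trans hc

lemma vol_le_sum (h : S ⊆ T) : vol H S ≤ ∑ x ∈ S, deg H T x := sum_le_sum fun x _ => deg_mono h x

lemma card_le_deg {N : Finset V} (h : ∀ y ∈ N, y ∈ S ∧ H.Adj x y) : #N ≤ deg H S x :=
  card_le_card fun y hy => mem_filter.2 (h y hy)

lemma sum_four {a b c d : V} (f : V → ℕ) (h : #{a, b, c, d} = 4) :
    ∑ u ∈ {a, b, c, d}, f u = f a + f b + f c + f d := by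
  obtain ⟨n1, n2, n3, n4, n5, n6⟩ := ne_of_card_four h
  rw [sum_insert (by simp [n1, n2, n3]), sum_insert (by simp [n4, n5]),
    sum_insert (by simp [n6]), sum_singleton]
  ring

lemma HasTriangle.six_le_vol {B : Finset V} (h : HasTriangle H B) (hB : #B = 4) : 6 ≤ vol H B := by
  obtain ⟨a, b, c, d, rfl, hab, hbc, hac⟩ := h
  rw [vol_four hB, if_pos hab, if_pos hbc, if_pos hac]
  omega

lemma HasClaw.six_le_vol {B : Finset V} (h : HasClaw H B) (hB : #B = 4) : 6 ≤ vol H B := by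
  obtain ⟨a, b, c, d, rfl, hab, hbc, hac⟩ := h
  rw [vol_four hB, if_pos hab, if_pos hbc, if_pos hac]
  omega

lemma hasCoPath_of_vol_lt {B : Finset V} (hB : #B = 4) (h : vol H B < 6) : HasCoPath H B := by
  rcases copath_or_triangle_or_claw hB h.le with h' | h' | h'
  · exact h'
  · exact (h.not_ge (h'.six_le_vol hB)).elim
  · exact (h.not_ge (h'.six_le_vol hB)).elim

/-- If a set of at least five vertices has few incident edges, then it contains a path on four
vertices of the complement with at most six incident edges. -/
lemma exists_hasCoPath {A : Finset V} (hA : 5 ≤ #A) (hAU : A ⊆ U)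
    (h : ∑ x ∈ A, deg H U x + 2 ≤ 2 * #A) :
    ∃ B ⊆ A, #B = 4 ∧ HasCoPath H B ∧ ∑ x ∈ B, deg H U x ≤ 6 := by
  obtain ⟨B, hBA, hB, hs⟩ := exists_subset_card_four (deg H U) (c := 6) (by omega) (by norm_num)
    (by omega : ∑ x ∈ A, deg H U x + 8 ≤ 2 * #A + 6)
  have hv : vol H B ≤ ∑ x ∈ B, deg H U x := vol_le_sum (hBA.trans hAU)
  rcases copath_or_triangle_or_claw hB (hv.trans hs) with hp | hp
  · exact ⟨B, hBA, hB, hp, hs⟩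
  have h6 : 6 ≤ vol H B := hp.elim (·.six_le_vol hB) (·.six_le_vol hB)
  obtain ⟨w, hw, hdw⟩ : ∃ w ∈ A \ B, deg H U w ≤ 2 := by
    by_contra! hcon
    have h1 : #(A \ B) • 3 ≤ ∑ x ∈ A \ B, deg H U x :=
      card_nsmul_le_sum _ _ 3 fun x hx => hcon x hx
    have h2 := sum_sdiff (f := deg H U) hBA
    have h3 := card_sdiff_add_card_eq_card hBA
    rw [smul_eq_mul] at h1
    omega
  obtain ⟨hwA, hwB⟩ := mem_sdiff.1 hw
  have hU : ∀ x ∈ B, x ∈ U := fun x hx => hAU (hBA hx)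
  rcases hp with ⟨a, b, c, d, rfl, hab, hbc, hac⟩ | ⟨a, b, c, d, rfl, hab, hac, had⟩
  all_goals
    obtain ⟨n1, n2, n3, n4, n5, n6⟩ := ne_of_card_four hB
    have ha := hU a (by simp)
    have hb := hU b (by simp)
    have hc := hU c (by simp)
    have hd := hU d (by simp)
    have hwU := hAU hwA
    simp only [mem_insert, mem_singleton, not_or] at hwB
    obtain ⟨wa, wb, wc, wd⟩ := hwB
    rw [sum_four _ hB] at hs
  · have da : #{b, c} ≤ deg H U a := card_le_deg (by simp [*])
    have db : #{a, c} ≤ deg H U b := card_le_deg (by simp [*, hab.symm])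
    have dc : #{a, b} ≤ deg H U c := card_le_deg (by simp [*, hac.symm, hbc.symm])
    rw [card_pair ‹_›] at da db dc
    have hB' : #{a, w, b, d} = 4 := by
      rw [card_eq_four]
      exact ⟨a, w, b, d, (Ne.symm wa), n1, n3, wb, wd, n5, rfl⟩
    refine ⟨{a, w, b, d}, ?_, hB', ⟨a, w, b, d, rfl, ?_, ?_, ?_⟩, ?_⟩
    · intro x hx
      simp only [mem_insert, mem_singleton] at hx
      rcases hx with rfl | rfl | rfl | rfl
      exacts [hBA (by simp), hwA, hBA (by simp), hBA (by simp)]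
    · intro hadj
      have : #{b, c, w} ≤ deg H U a := card_le_deg (by simp [*])
      rw [card_eq_three.2 ⟨b, c, w, n4, (Ne.symm wb), (Ne.symm wc), rfl⟩] at this
      omega
    · intro hadj
      have : #{a, c, w} ≤ deg H U b := card_le_deg (by simp [*, hab.symm, hadj.symm])
      rw [card_eq_three.2 ⟨a, c, w, n2, (Ne.symm wa), (Ne.symm wc), rfl⟩] at this
      omega
    · intro hadj
      have : #{a, c, d} ≤ deg H U b := card_le_deg (by simp [*, hab.symm])
      rw [card_eq_three.2 ⟨a, c, d, n2, n3, n6, rfl⟩] at this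
      omega
    · rw [sum_four _ hB']
      omega
  · have da : #{b, c, d} ≤ deg H U a := card_le_deg (by simp [*])
    have db : #{a} ≤ deg H U b := card_le_deg (by simp [*, hab.symm])
    have dc : #{a} ≤ deg H U c := card_le_deg (by simp [*, hac.symm])
    have dd : #{a} ≤ deg H U d := card_le_deg (by simp [*, had.symm])
    rw [card_singleton] at db dc dd
    rw [card_eq_three.2 ⟨b, c, d, n4, n5, n6, rfl⟩] at da
    have hB' : #{b, c, d, w} = 4 := by
      rw [card_eq_four]
      exact ⟨b, c, d, w, n4, n5, (Ne.symm wb), n6, (Ne.symm wc), (Ne.symm wd), rfl⟩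
    refine ⟨{b, c, d, w}, ?_, hB', ⟨b, c, d, w, rfl, ?_, ?_, ?_⟩, ?_⟩
    · intro x hx
      simp only [mem_insert, mem_singleton] at hx
      rcases hx with rfl | rfl | rfl | rfl
      exacts [hBA (by simp), hBA (by simp), hBA (by simp), hwA]
    · intro hadj
      have : #{a, c} ≤ deg H U b := card_le_deg (by simp [*, hab.symm])
      rw [card_pair n2] at this
      omega
    · intro hadj
      have : #{a, d} ≤ deg H U c := card_le_deg (by simp [*, hac.symm])
      rw [card_pair n3] at this
      omega
    · intro hadj
      have : #{a, w} ≤ deg H U d := card_le_deg (by simp [*, had.symm])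
      rw [card_pair (Ne.symm wa)] at this
      omega
    · rw [sum_four _ hB']
      omega

lemma deg_nonisolated (hx : x ∈ S) : deg H (nonisolated H S) x = deg H S x := by
  refine (deg_mono nonisolated_subset x).antisymm (card_le_deg fun y hy => ?_)
  obtain ⟨hyS, hxy⟩ := mem_filter.1 hy
  exact ⟨mem_nonisolated.2 ⟨hyS, deg_pos_iff.2 ⟨x, hx, hxy.symm⟩⟩, hxy⟩

lemma exists_not_adj (h : vol H T < #T * (#T - 1)) : ∃ a ∈ T, ∃ b ∈ T, a ≠ b ∧ ¬ H.Adj a b := by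
  by_contra! hcon
  refine h.not_ge ?_
  rw [← smul_eq_mul]
  refine card_nsmul_le_sum T _ _ fun x hx => ?_
  rw [← card_erase_of_mem hx]
  exact card_le_deg fun y hy => ⟨mem_of_mem_erase hy, hcon x hx y (mem_of_mem_erase hy)
    (ne_of_mem_erase hy).symm⟩

lemma Splits.of_pair {p : ℕ} {a b : V} (h : Splits H ((T.erase a).erase b) p) (ha : a ∈ T)
    (hb : b ∈ T) (hne : a ≠ b) (hab : ¬ H.Adj a b) : Splits H T (p + 1) := by
  have := h.union (C := {a, b}) (by simp [hab, mt H.adj_symm hab])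
  rwa [insert_union, singleton_union, insert_erase (mem_erase.2 ⟨hne.symm, hb⟩),
    insert_erase ha] at this

lemma card_erase_pair {a b : V} (ha : a ∈ T) (hb : b ∈ T) (hne : a ≠ b) :
    #((T.erase a).erase b) + 2 = #T := by
  have h1 := card_erase_add_one (mem_erase.2 ⟨hne.symm, hb⟩)
  have h2 := card_erase_add_one ha
  omega

lemma vol_erase_pair {a b : V} (ha : a ∈ T) (hb : b ∈ T) (hne : a ≠ b) (hab : ¬ H.Adj a b) :
    vol H T = vol H ((T.erase a).erase b) + 2 * deg H T a + 2 * deg H T b := by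
  have h1 := deg_insert (H := H) (notMem_erase a T) b
  rw [insert_erase ha, if_neg fun h => hab (H.adj_symm h)] at h1
  rw [vol_erase ha, vol_erase (mem_erase.2 ⟨hne.symm, hb⟩)]
  omega

lemma vol_nonisolated_le : vol H (nonisolated H S) ≤ vol H S := vol_mono nonisolated_subset

lemma packs_of_card_nonisolated (hS : S.Nonempty) (h : 3 * #(nonisolated H S) ≤ #S) :
    Packs H S :=
  (splits_card _).packs hS (by omega)

lemma packs_of_pair (hS : S.Nonempty)
    (hv : vol H S < #(nonisolated H S) * (#(nonisolated H S) - 1))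
    (h : 3 * #(nonisolated H S) ≤ #S + 2) : Packs H S := by
  obtain ⟨a, ha, b, hb, hne, hab⟩ := exists_not_adj (vol_nonisolated_le.trans_lt hv)
  have hc := card_erase_pair ha hb hne
  exact ((splits_card _).of_pair ha hb hne hab).packs hS (by omega)

lemma packs_of_two_pairs (hS : S.Nonempty) {δ : ℕ} (hδ : ∀ x ∈ nonisolated H S, δ ≤ deg H S x)
    (hv : vol H S < #(nonisolated H S) * (#(nonisolated H S) - 1))
    (hv' : vol H S < (#(nonisolated H S) - 2) * (#(nonisolated H S) - 2 - 1) + 4 * δ)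
    (h : 3 * #(nonisolated H S) ≤ #S + 4) : Packs H S := by
  obtain ⟨a, ha, b, hb, hne, hab⟩ := exists_not_adj (vol_nonisolated_le.trans_lt hv)
  have hc := card_erase_pair ha hb hne
  have hvol := vol_erase_pair ha hb hne hab
  rw [deg_nonisolated (nonisolated_subset ha), deg_nonisolated (nonisolated_subset hb)] at hvol
  have hda := hδ a ha
  have hdb := hδ b hb
  have hle := vol_nonisolated_le (H := H) (S := S)
  have hc' : #(((nonisolated H S).erase a).erase b) = #(nonisolated H S) - 2 := by omega
  obtain ⟨a', ha', b', hb', hne', hab'⟩ := exists_not_adj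
    (T := ((nonisolated H S).erase a).erase b) (H := H) (by rw [hc']; omega)
  have hc'' := card_erase_pair ha' hb' hne'
  exact (((splits_card _).of_pair ha' hb' hne' hab').of_pair ha hb hne hab).packs hS (by omega)

lemma splits_of_cubic (hT : #T = 6) (hd : ∀ x ∈ T, deg H T x = 3) : ∃ p ≤ 3, Splits H T p := by
  have hv : vol H T = 18 := by
    unfold vol
    rw [sum_congr rfl hd, sum_const, hT, smul_eq_mul]
  obtain ⟨a, ha, b, hb, hne, hab⟩ := exists_not_adj (H := H) (T := T) (by rw [hv, hT]; norm_num)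
  have hc := card_erase_pair ha hb hne
  have hvol := vol_erase_pair ha hb hne hab
  rw [hd a ha, hd b hb] at hvol
  have h4 : #((T.erase a).erase b) = 4 := by omega
  have hsub : ∀ z ∈ (T.erase a).erase b, z ≠ a ∧ z ≠ b ∧ z ∈ T := by
    simp only [mem_erase]; tauto
  have hcov : ∀ z ∈ T, z = a ∨ z = b ∨ z ∈ (T.erase a).erase b := by
    simp only [mem_erase]; tauto
  have hcp := copath_or_triangle_or_claw h4 (H := H) (by omega)
  generalize hT' : (T.erase a).erase b = T' at *
  rcases hcp with ⟨p, q, r, s, rfl, hpq, hqr, hrs⟩ | ⟨p, q, r, s, rfl, hpq, hqr, hpr⟩ |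
    ⟨c, p, q, r, rfl, hcp, hcq, hcr⟩ <;> obtain ⟨n1, n2, n3, n4, n5, n6⟩ := ne_of_card_four h4
  · refine ⟨3, le_rfl, Splits.of_pair ?_ ha hb hne hab⟩
    rw [hT']
    have h1 : Splits H {r, s} 1 := by
      simpa using splits_empty.union (C := {r, s}) (by simp [hrs, mt H.adj_symm hrs])
    have h2 := h1.union (C := {p, q}) (by simp [hpq, mt H.adj_symm hpq])
    rwa [insert_union, singleton_union] at h2
  · exfalso
    rw [vol_four h4, if_pos hpq, if_pos hqr, if_pos hpr] at hvol
    have hs := hd s (hsub s (by simp)).2.2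
    have : deg H T s ≤ #{a, b} := card_le_card fun z hz => by
      obtain ⟨hzT, hz⟩ := mem_filter.1 hz
      rcases hcov z hzT with rfl | rfl | hzT'
      · simp
      · simp
      exfalso
      simp only [mem_insert, mem_singleton] at hzT'
      rcases hzT' with rfl | rfl | rfl | rfl
      · rw [if_pos hz.symm] at hvol; omega
      · rw [if_pos hz.symm] at hvol; omega
      · rw [if_pos hz.symm] at hvol; omega
      · exact H.loopless.irrefl _ hz
    rw [card_pair hne] at this
    omega
  · rw [vol_four h4, if_pos hcp, if_pos hcq, if_pos hcr] at hvol
    have hdc := hd c (hsub c (by simp)).2.2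
    have hnc : ∀ z ∈ T, z ≠ p → z ≠ q → z ≠ r → ¬ H.Adj c z := by
      intro z hz h1 h2 h3 hadj
      have : #{z, p, q, r} ≤ deg H T c := card_le_deg (by simp [*])
      rw [card_eq_four.2 ⟨z, p, q, r, h1, h2, h3, n4, n5, n6, rfl⟩] at this
      omega
    have hp := hsub p (by simp)
    have hq := hsub q (by simp)
    have hr := hsub r (by simp)
    have hca := hnc a ha hp.1.symm hq.1.symm hr.1.symm
    have hcb := hnc b hb hp.2.1.symm hq.2.1.symm hr.2.1.symm
    have h1 : Splits H {c, a, b} 1 := by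
      simpa using splits_empty.union (C := {c, a, b}) (by simp [*, H.adj_comm _ c, H.adj_comm b a])
    have hpq : ¬ H.Adj p q := fun h => by rw [if_pos h] at hvol; omega
    have hpr : ¬ H.Adj p r := fun h => by rw [if_pos h] at hvol; omega
    have hqr : ¬ H.Adj q r := fun h => by rw [if_pos h] at hvol; omega
    have h2 := h1.union (C := {p, q, r}) (by simp [*, H.adj_comm _ p, H.adj_comm r q])
    refine ⟨2, by norm_num, ?_⟩
    convert h2 using 1
    ext z
    constructor
    · intro hz
      rcases hcov z hz with rfl | rfl | hz
      · simp
      · simp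
      simp only [mem_insert, mem_singleton, mem_union] at hz ⊢
      tauto
    · intro hz
      simp only [mem_insert, mem_singleton, mem_union] at hz
      rcases hz with (rfl | rfl | rfl) | rfl | rfl | rfl
      exacts [hp.2.2, hq.2.2, hr.2.2, (hsub _ (by simp)).2.2, ha, hb]

lemma packs_of_cubic (hS : 12 ≤ #S) (h6 : #(nonisolated H S) = 6)
    (hd : ∀ x ∈ nonisolated H S, deg H S x = 3) : Packs H S := by
  obtain ⟨p, hp, hsp⟩ := splits_of_cubic h6 fun x hx =>
    (deg_nonisolated (nonisolated_subset hx)).trans (hd x hx)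
  exact hsp.packs (card_pos.1 (by omega)) (by omega)

lemma deg_lt_card_nonisolated (hx : x ∈ nonisolated H S) : deg H S x < #(nonisolated H S) := by
  rw [← deg_nonisolated (nonisolated_subset hx), deg]
  exact card_lt_card ((filter_ssubset).2 ⟨x, hx, H.loopless.irrefl x⟩)

lemma card_nonisolated_mul_le {δ : ℕ} (hδ : ∀ x ∈ nonisolated H S, δ ≤ deg H S x) :
    #(nonisolated H S) * δ ≤ vol H S := by
  rw [vol_eq_nonisolated_sum, ← smul_eq_mul]
  exact card_nsmul_le_sum _ _ _ hδ

lemma packs_of_le_deg (hS : S.Nonempty) {δ : ℕ} (hδ : ∀ x ∈ nonisolated H S, δ ≤ deg H S x)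
    (h : ∀ k, k * δ ≤ vol H S → k = 0 ∨ δ + 1 ≤ k → k = #(nonisolated H S) → 3 * k ≤ #S ∨
      3 * k ≤ #S + 2 ∧ vol H S < k * (k - 1) ∨
      3 * k ≤ #S + 4 ∧ vol H S < k * (k - 1) ∧ vol H S < (k - 2) * (k - 2 - 1) + 4 * δ) :
    Packs H S := by
  have hk : #(nonisolated H S) = 0 ∨ δ + 1 ≤ #(nonisolated H S) := by
    rcases (nonisolated H S).eq_empty_or_nonempty with h0 | ⟨x, hx⟩
    · exact Or.inl (card_eq_zero.2 h0)
    · exact Or.inr (Nat.lt_of_le_of_lt (hδ x hx) (deg_lt_card_nonisolated hx))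
  rcases h _ (card_nonisolated_mul_le hδ) hk rfl with h | ⟨h, hv⟩ | ⟨h, hv, hv'⟩
  · exact packs_of_card_nonisolated hS h
  · exact packs_of_pair hS hv h
  · exact packs_of_two_pairs hS hδ hv hv' h

lemma card_nonisolated_le_erase (hx : x ∈ S) :
    #(nonisolated H S) ≤ #(nonisolated H (S.erase x)) + deg H S x + 1 := by
  have : nonisolated H S ⊆ insert x (nonisolated H (S.erase x) ∪ {y ∈ S | H.Adj x y}) := by
    intro z hz
    obtain ⟨hzS, hz⟩ := mem_nonisolated.1 hz
    obtain ⟨y, hy, hzy⟩ := deg_pos_iff.1 hz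
    simp only [mem_insert, mem_union, mem_nonisolated, deg_pos_iff, mem_erase, mem_filter]
    by_cases hzx : z = x
    · exact Or.inl hzx
    by_cases hxz : H.Adj x z
    · exact Or.inr (Or.inr ⟨hzS, hxz⟩)
    · refine Or.inr (Or.inl ⟨⟨hzx, hzS⟩, y, ⟨?_, hy⟩, hzy⟩)
      rintro rfl
      exact hxz hzy.symm
  have h1 := card_le_card this
  have h2 := card_insert_le x (nonisolated H (S.erase x) ∪ {y ∈ S | H.Adj x y})
  have h3 := card_union_le (nonisolated H (S.erase x)) {y ∈ S | H.Adj x y}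
  rw [← deg] at h3
  omega

lemma packs_of_vol_add_twelve_le (h : vol H S + 12 ≤ 2 * #S) : Packs H S := by
  induction hn : #S using Nat.strong_induction_on generalizing S with
  | _ n ih =>
    by_cases hx : ∃ x ∈ S, 1 ≤ deg H S x ∧ 4 * deg H S x + 2 ≤ #S
    · obtain ⟨x, hx, h1, h2⟩ := hx
      have hc := card_erase_add_one hx
      have hv := vol_erase (H := H) hx
      exact (ih #(S.erase x) (by omega) (by omega) rfl).of_erase hx h2
    push Not at hx
    refine packs_of_le_deg (card_pos.1 (by omega)) (δ := (#S + 2) / 4) (fun x hxn => ?_)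
      fun k hk hk' _ => ?_
    · have := hx x (nonisolated_subset hxn) (mem_nonisolated.1 hxn).2
      omega
    · generalize hδ : (#S + 2) / 4 = δ at *
      left
      have : k ≤ 7 := by
        by_contra! hcon
        have := Nat.mul_le_mul_right δ hcon
        omega
      interval_cases k <;> omega

lemma packs_of_vol_add_ten_le (h : vol H S + 10 ≤ 2 * #S) (h8 : #S = 8 → #(nonisolated H S) ≠ 3)
    (h11 : #S = 11 → #(nonisolated H S) ≠ 4) : Packs H S := by
  induction hn : #S using Nat.strong_induction_on generalizing S with
  | _ n ih =>
    by_cases hx : ∃ x ∈ S, 2 ≤ deg H S x ∧ 4 * deg H S x + 2 ≤ #S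
    · obtain ⟨x, hx, h1, h2⟩ := hx
      have hc := card_erase_add_one hx
      have hv := vol_erase (H := H) hx
      exact (packs_of_vol_add_twelve_le (by omega)).of_erase hx h2
    push Not at hx
    by_cases hy : ∃ x ∈ S, deg H S x = 1
    · obtain ⟨x, hxS, h1⟩ := hy
      have hv := vol_erase (H := H) hxS
      have hv' := vol_deleteIncidenceSet (H := H) hxS
      have hc := card_erase_add_one hxS
      have hk := card_nonisolated_le_erase (H := H) hxS
      by_cases hi : 4 + #(nonisolated H S) ≤ #S
      · exact (packs_of_vol_add_twelve_le (by omega)).of_deleteIncidenceSet hxS (by omega)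
      · exact (ih #(S.erase x) (by omega) (by omega) (by omega) (by omega) rfl).of_erase hxS
          (by omega)
    push Not at hy
    refine packs_of_le_deg (card_pos.1 (by omega)) (δ := max 2 ((#S + 2) / 4)) (fun x hxn => ?_)
      fun k hk hk' hk'' => ?_
    · have := hx x (nonisolated_subset hxn)
      have := hy x (nonisolated_subset hxn)
      have := (mem_nonisolated.1 hxn).2
      omega
    · rw [← hk''] at h8 h11
      generalize hδ : max 2 ((#S + 2) / 4) = δ at *
      have : k ≤ 7 := by
        by_contra! hcon
        have := Nat.mul_le_mul_right δ hcon
        omega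
      interval_cases k <;> omega

/-- The vertices of degree one in the subgraph induced on `S`. -/
noncomputable def leaves (H : SimpleGraph V) (S : Finset V) : Finset V := {x ∈ S | deg H S x = 1}

/-- The vertices of degree at least two in the subgraph induced on `S`. -/
noncomputable def branches (H : SimpleGraph V) (S : Finset V) : Finset V := {x ∈ S | 2 ≤ deg H S x}

lemma mem_leaves : x ∈ leaves H S ↔ x ∈ S ∧ deg H S x = 1 := mem_filter

lemma mem_branches : x ∈ branches H S ↔ x ∈ S ∧ 2 ≤ deg H S x := mem_filter

lemma disjoint_branches_leaves : Disjoint (branches H S) (leaves H S) :=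
  disjoint_left.2 fun x hb hl => by
    have := (mem_branches.1 hb).2
    have := (mem_leaves.1 hl).2
    omega

lemma branches_union_leaves : branches H S ∪ leaves H S = nonisolated H S := by
  ext x
  simp only [mem_union, mem_branches, mem_leaves, mem_nonisolated, ← and_or_left]
  exact and_congr_right fun _ => by omega

lemma card_branches_add_card_leaves : #(branches H S) + #(leaves H S) = #(nonisolated H S) := by
  rw [← card_union_of_disjoint disjoint_branches_leaves, branches_union_leaves]

lemma sum_branches_add_card_leaves :
    ∑ x ∈ branches H S, deg H S x + #(leaves H S) = vol H S := by
  rw [vol_eq_nonisolated_sum, ← branches_union_leaves, sum_union disjoint_branches_leaves,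
    sum_congr rfl fun x (hx : x ∈ leaves H S) => (mem_leaves.1 hx).2]
  simp

lemma deg_branches_add_deg_leaves (hx : x ∈ S) :
    deg H (branches H S) x + deg H (leaves H S) x = deg H S x := by
  rw [← deg_nonisolated hx, ← branches_union_leaves, deg, deg, deg, filter_union,
    card_union_of_disjoint (disjoint_branches_leaves.mono (filter_subset _ _) (filter_subset _ _))]

lemma deg_lt_card (hx : x ∈ S) : deg H S x < #S :=
  card_lt_card (filter_ssubset.2 ⟨x, hx, H.loopless.irrefl x⟩)

lemma packs_star {v : V} {j : ℕ} (hv : v ∈ S) (hj : j ≤ deg H (leaves H S) v)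
    (hd : 4 * deg H S v + 2 ≤ #S + 3 * j) (hS : 6 + j ≤ #S)
    (h : ∀ U ⊆ S, #U + j + 1 = #S → vol H U + 2 * deg H S v ≤ vol H S →
      #(nonisolated H S) ≤ #(nonisolated H U) + deg H S v + 1 → Packs H U) : Packs H S := by
  obtain ⟨J, hJ, rfl⟩ := exists_subset_card_eq hj
  have hJ' : ∀ x ∈ J, x ∈ S ∧ H.Adj v x ∧ deg H S x = 1 := fun x hx => by
    obtain ⟨h1, h2⟩ := mem_filter.1 (hJ hx)
    exact ⟨(mem_leaves.1 h1).1, h2, (mem_leaves.1 h1).2⟩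
  have hJS : J ⊆ S.erase v := fun x hx => mem_erase.2 ⟨(hJ' x hx).2.1.ne', (hJ' x hx).1⟩
  refine Packs.of_star hv hJ' hd hS (h _ (sdiff_subset.trans (erase_subset _ _)) ?_ ?_ ?_)
  · rw [card_sdiff_add_card_eq_card hJS, card_erase_add_one hv]
  · rw [vol_erase hv]
    have := vol_mono (H := H) (sdiff_subset (s := S.erase v) (t := J))
    omega
  · refine (card_nonisolated_le_erase hv).trans ?_
    gcongr
    intro z hz
    obtain ⟨hzS, hz⟩ := mem_nonisolated.1 hz
    obtain ⟨y, hy, hzy⟩ := deg_pos_iff.1 hz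
    have key : ∀ x ∈ J, ∀ y ∈ S.erase v, ¬ H.Adj x y := by
      intro x hx y hy hxy
      have : #{v, y} ≤ deg H S x := 
        card_le_deg (by simp [hv, mem_of_mem_erase hy, hxy, (hJ' x hx).2.1.symm])
      rw [card_pair (ne_of_mem_erase hy).symm, (hJ' x hx).2.2] at this
      omega
    exact mem_nonisolated.2 ⟨mem_sdiff.2 ⟨hzS, fun h => key z h y hy hzy⟩,
      deg_pos_iff.2 ⟨y, mem_sdiff.2 ⟨hy, fun h => key y h z hzS hzy.symm⟩, hzy⟩⟩

lemma packs_block {v : V} {B : Finset V} (hv : v ∈ S) (hB : B ⊆ nonNbrs H S v) (hB4 : #B = 4)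
    (hp : HasCoPath H B) (hd : 2 * ∑ b ∈ B, deg H S b + 5 < #S ∨
      vol H S + 5 < #S + 2 * deg H S v) (hS : 7 ≤ #S)
    (h : ∀ U ⊆ S.erase v, #U + 5 = #S →
      vol H U + 2 * deg H S v ≤ vol H S → Packs H U) : Packs H S := by
  have h1 := vol_block hv hB
  have h2 := card_block hv hB
  have h3 : ∑ b ∈ B, deg H (S.erase v \ B) b ≤ ∑ b ∈ B, deg H S b :=
    sum_le_sum fun b _ => deg_mono (sdiff_subset.trans (erase_subset _ _)) b
  exact Packs.of_block hv hB hB4 hp (h _ sdiff_subset (by omega) (by omega)) (by omega) hS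

lemma sum_add_card_nonisolated_le {W : Finset V} (hW : W ⊆ nonisolated H S) :
    ∑ x ∈ W, deg H S x + #(nonisolated H S) ≤ vol H S + #W := by
  rw [vol_eq_nonisolated_sum, ← sum_sdiff hW, ← card_sdiff_add_card_eq_card hW]
  have : #(nonisolated H S \ W) • 1 ≤ ∑ x ∈ nonisolated H S \ W, deg H S x :=
    card_nsmul_le_sum _ _ _ fun x hx => (mem_nonisolated.1 (mem_sdiff.1 hx).1).2
  rw [smul_eq_mul] at this
  omega

lemma deg_eq_of_vol_le {δ : ℕ} (hδ : ∀ x ∈ nonisolated H S, δ ≤ deg H S x)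
    (h : vol H S ≤ #(nonisolated H S) * δ) (hx : x ∈ nonisolated H S) : deg H S x = δ := by
  refine ((hδ x hx).antisymm ?_).symm
  by_contra! hcon
  have := sum_lt_sum hδ ⟨x, hx, hcon⟩
  rw [← vol_eq_nonisolated_sum, sum_const, smul_eq_mul] at this
  omega

/-- If every branch vertex has many branch neighbours, then there are many branch vertices. -/
lemma branches_bounds {a s : ℕ} (ha : ∀ x ∈ branches H S, a ≤ deg H S x)
    (hs : ∀ x ∈ branches H S, deg H (leaves H S) x + s ≤ deg H S x) :
    a * #(branches H S) + #(leaves H S) ≤ vol H S ∧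
      (#(branches H S) = 0 ∨ s + 1 ≤ #(branches H S)) := by
  constructor
  · rw [← sum_branches_add_card_leaves, mul_comm, ← smul_eq_mul]
    gcongr
    exact card_nsmul_le_sum _ _ _ ha
  · rcases (branches H S).eq_empty_or_nonempty with h0 | ⟨x, hx⟩
    · exact Or.inl (card_eq_zero.2 h0)
    · have h1 := deg_branches_add_deg_leaves (H := H) (mem_branches.1 hx).1
      have h2 := hs x hx
      have h3 := deg_lt_card (H := H) hx
      omega

lemma exists_hasCoPath_nonNbrs {v : V} (hv : v ∈ S) (h4 : deg H S v + 5 ≤ #S)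
    (h : vol H S + 6 ≤ 2 * #S) :
    ∃ B ⊆ nonNbrs H S v, #B = 4 ∧ HasCoPath H B := by
  have hA := card_nonNbrs (H := H) hv
  have hAs := sum_nonNbrs (H := H) hv
  obtain ⟨B, hB, hB4, hBs⟩ := exists_subset_card_four (A := nonNbrs H S v) (deg H S) (c := 4)
    (by omega) le_rfl (by omega)
  refine ⟨B, hB, hB4, hasCoPath_of_vol_lt hB4 ?_⟩
  have := vol_le_sum (H := H) (hB.trans ((filter_subset _ _).trans (erase_subset v S)))
  omega

/-- The case of thirteen vertices with a vertex of degree at least six. -/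
lemma packs_thirteen_of_le_deg {v : V} (hS : #S = 13) (hvol : vol H S ≤ 18)
    (hk : 10 ≤ #(nonisolated H S)) (h2 : ∀ x ∈ S, deg H S x ≠ 2) (hv : v ∈ S)
    (hd : 6 ≤ deg H S v) (hd' : deg H S v ≤ 7) : Packs H S := by
  obtain ⟨B, hB, hB4, hp⟩ := exists_hasCoPath_nonNbrs (H := H) hv (by omega) (by omega)
  refine packs_block hv hB hB4 hp (Or.inr (by omega)) (by omega) fun U hU hUc hUv => ?_
  by_cases h8 : vol H U ≤ 4
  · exact packs_of_vol_add_twelve_le (by omega)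
  refine packs_of_vol_add_ten_le (by omega) (fun _ h3 => ?_) (by omega)
  have hUS : U ⊆ S := hU.trans (erase_subset _ _)
  have hvU : v ∉ nonisolated H U := fun h => by simpa using hU (nonisolated_subset h)
  have hsub : insert v (nonisolated H U) ⊆ nonisolated H S := by
    refine insert_subset (mem_nonisolated.2 ⟨hv, by omega⟩) fun x hx => ?_
    obtain ⟨hxU, hx⟩ := mem_nonisolated.1 hx
    exact mem_nonisolated.2 ⟨hUS hxU, hx.trans_le (deg_mono hUS x)⟩
  have h1 := sum_add_card_nonisolated_le hsub
  rw [sum_insert hvU, card_insert_of_notMem hvU] at h1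
  have h5 : ∑ x ∈ nonisolated H U, 2 * deg H U x ≤ ∑ x ∈ nonisolated H U, (deg H S x + 1) := by
    refine sum_le_sum fun x hx => ?_
    have h6 := deg_lt_card_nonisolated hx
    have h7 := (mem_nonisolated.1 hx).2
    have h8 := deg_mono (H := H) hUS x
    have h9 := h2 x (hUS (nonisolated_subset hx))
    omega
  rw [← mul_sum, ← vol_eq_nonisolated_sum, sum_add_distrib, sum_const, h3] at h5
  simp only [smul_eq_mul] at h5
  omega

/-- Four vertices of a complete graph together with three disjoint edges. -/
lemma packs_thirteen_of_four_branches (hS : #S = 13) (hvol : vol H S = 18)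
    (hk : #(nonisolated H S) = 10) (hb : #(branches H S) = 4) (hl : #(leaves H S) = 6)
    (hb3 : ∀ x ∈ branches H S, 3 ≤ deg H S x)
    (hs : ∀ x ∈ branches H S, deg H (leaves H S) x + 3 ≤ deg H S x) : Packs H S := by
  obtain ⟨x, hx⟩ : (leaves H S).Nonempty := card_pos.1 (by omega)
  obtain ⟨hxS, hx1⟩ := mem_leaves.1 hx
  obtain ⟨y, hy, hxy⟩ := deg_pos_iff.1 (by omega : 0 < deg H S x)
  have hsum := sum_branches_add_card_leaves (H := H) (S := S)
  have hyl : y ∈ leaves H S := by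
    by_contra hyl
    have hyb : y ∈ branches H S := by
      have : y ∈ nonisolated H S := mem_nonisolated.2 ⟨hy, deg_pos_iff.2 ⟨x, hxS, hxy.symm⟩⟩
      rw [← branches_union_leaves] at this
      exact (mem_union.1 this).resolve_right hyl
    have h1 : 0 < deg H (leaves H S) y := deg_pos_iff.2 ⟨x, hx, hxy.symm⟩
    have h2 := hs y hyb
    have h3 := sum_lt_sum hb3 ⟨y, hyb, by omega⟩
    rw [sum_const, hb, smul_eq_mul] at h3
    omega
  obtain ⟨-, hy1⟩ := mem_leaves.1 hyl
  have hys : ∀ z ∈ S, z ≠ x → ¬ H.Adj y z := by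
    intro z hz hzx hyz
    have : #{x, z} ≤ deg H S y := card_le_deg (by simp [*, hxy.symm])
    rw [card_pair hzx.symm] at this
    omega
  have hxs : ∀ z ∈ S, z ≠ y → ¬ H.Adj x z := by
    intro z hz hzx hyz
    have : #{y, z} ≤ deg H S x := card_le_deg (by simp [*])
    rw [card_pair hzx.symm] at this
    omega
  have hkc : #(nonisolated H (S.erase x)) ≤ 8 := by
    have : nonisolated H (S.erase x) ⊆ ((nonisolated H S).erase x).erase y := by
      intro z hz
      obtain ⟨hzS, hz⟩ := mem_nonisolated.1 hz
      obtain ⟨w, hw, hzw⟩ := deg_pos_iff.1 hz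
      refine mem_erase.2 ⟨?_, mem_erase.2 ⟨ne_of_mem_erase hzS, mem_nonisolated.2
        ⟨mem_of_mem_erase hzS, hz.trans_le (deg_mono (erase_subset _ _) _)⟩⟩⟩
      rintro rfl
      exact hys w (mem_of_mem_erase hw) (ne_of_mem_erase hw) hzw
    have h1 := card_le_card this
    have h2 := card_erase_pair (T := nonisolated H S) (mem_nonisolated.2 ⟨hxS, by omega⟩)
      (mem_nonisolated.2 ⟨hy, by omega⟩) hxy.ne
    omega
  obtain ⟨z, hz, hzn⟩ : ∃ z ∈ leaves H S, z ∉ ({x, y} : Finset V) := by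
    refine exists_mem_notMem_of_card_lt_card ?_
    rw [card_pair hxy.ne]
    omega
  simp only [mem_insert, mem_singleton, not_or] at hzn
  obtain ⟨hzS, hz1⟩ := mem_leaves.1 hz
  have hzS' : z ∈ S.erase x := mem_erase.2 ⟨hzn.1, hzS⟩
  have hzd : deg H (S.erase x) z = 1 := by
    have := deg_insert (H := H) (notMem_erase x S) z
    rw [insert_erase hxS, if_neg fun h => hxs z hzS hzn.2 h.symm] at this
    omega
  have hc := card_erase_add_one hxS
  have hv := vol_erase (H := H) hxS
  have hv' := vol_deleteIncidenceSet (H := H) hzS'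
  refine Packs.of_erase ?_ hxS (by omega)
  exact (packs_of_vol_add_ten_le (by omega) (by omega) (by omega)).of_deleteIncidenceSet hzS'
    (by omega)

lemma packs_thirteen (hS : #S = 13) (hvol : vol H S ≤ 18) (hd : ∀ x ∈ S, deg H S x ≤ 7)
    (hk : 10 ≤ #(nonisolated H S)) (h2 : ∀ x ∈ S, deg H S x ≠ 2) : Packs H S := by
  by_cases h6 : ∃ v ∈ S, 6 ≤ deg H S v
  · obtain ⟨v, hv, h6⟩ := h6
    exact packs_thirteen_of_le_deg hS hvol hk h2 hv h6 (hd v hv)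
  push Not at h6
  by_cases hj : ∃ v ∈ branches H S, deg H S v ≤ deg H (leaves H S) v + 2
  · obtain ⟨v, hv, hj⟩ := hj
    obtain ⟨hvS, hv2⟩ := mem_branches.1 hv
    have := h6 v hvS
    have := h2 v hvS
    refine packs_star (j := deg H S v - 2) hvS (by omega) (by omega) (by omega)
      fun U _ hUc hUv hUk => packs_of_vol_add_ten_le (by omega) (by omega) (by omega)
  push Not at hj
  have hb : ∀ x ∈ branches H S, 3 ≤ deg H S x := fun x hx => by
    have := h2 x (mem_branches.1 hx).1
    have := (mem_branches.1 hx).2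
    omega
  obtain ⟨h3, h4⟩ := branches_bounds (s := 3) hb fun x hx => by have := hj x hx; omega
  have h5 := card_branches_add_card_leaves (H := H) (S := S)
  rcases h4 with h0 | h4
  · have h7 := sum_branches_add_card_leaves (H := H) (S := S)
    rw [card_eq_zero.1 h0, sum_empty] at h7
    have h8 : #(leaves H S) ≤ #S := card_le_card (filter_subset _ _)
    exact packs_of_vol_add_twelve_le (by omega)
  · exact packs_thirteen_of_four_branches hS (by omega) (by omega) (by omega) (by omega) hb
      fun x hx => by have := hj x hx; omega

lemma packs_of_vol_add_eight_le (h13 : 13 ≤ #S) (h18 : #S ≤ 18) (h : vol H S + 8 ≤ 2 * #S)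
    (hd : ∀ x ∈ S, deg H S x ≤ 7) (h14 : #S = 14 → #(nonisolated H S) ≠ 5) : Packs H S := by
  induction hn : #S using Nat.strong_induction_on generalizing S with
  | _ n ih =>
    by_cases hx : ∃ x ∈ S, 2 ≤ deg H S x ∧ 4 * deg H S x + 2 ≤ #S
    · obtain ⟨x, hx, h1, h2⟩ := hx
      have hc := card_erase_add_one hx
      have hv := vol_erase (H := H) hx
      exact (packs_of_vol_add_ten_le (by omega) (by omega) (by omega)).of_erase hx h2
    push Not at hx
    by_cases hy : ∃ x ∈ S, deg H S x = 1
    · obtain ⟨x, hxS, h1⟩ := hy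
      have hv := vol_erase (H := H) hxS
      have hv' := vol_deleteIncidenceSet (H := H) hxS
      have hc := card_erase_add_one hxS
      have hk := card_nonisolated_le_erase (H := H) hxS
      by_cases hi : 4 + #(nonisolated H S) ≤ #S
      · exact (packs_of_vol_add_ten_le (by omega) (by omega) (by omega)).of_deleteIncidenceSet hxS
          (by omega)
      by_cases hS : #S = 13
      · refine packs_thirteen hS (by omega) hd (by omega) fun x hxS h2 => ?_
        have := hx x hxS
        omega
      · exact (ih #(S.erase x) (by omega) (by omega) (by omega) (by omega) (fun y hy =>
          (deg_mono (erase_subset _ _) y).trans (hd y (mem_of_mem_erase hy))) (by omega)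
          rfl).of_erase hxS (by omega)
    push Not at hy
    have hδ : ∀ x ∈ nonisolated H S, (#S + 2) / 4 ≤ deg H S x := fun x hxn => by
      have := hx x (nonisolated_subset hxn)
      have := hy x (nonisolated_subset hxn)
      have := (mem_nonisolated.1 hxn).2
      omega
    by_cases h6 : #S = 13 ∧ #(nonisolated H S) = 6
    · refine packs_of_cubic (by omega) h6.2 fun x hx => ?_
      have := deg_eq_of_vol_le hδ (by rw [h6.1, h6.2]; omega) hx
      omega
    refine packs_of_le_deg (card_pos.1 (by omega)) hδ fun k hk hk' hk'' => ?_
    rw [← hk''] at h14 h6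
    generalize hδ : (#S + 2) / 4 = δ at *
    have : k ≤ 7 := by
      by_contra! hcon
      have := Nat.mul_le_mul_right δ hcon
      omega
    interval_cases k <;> omega

lemma packs_seventeen (hS : #S = 17) (hvol : vol H S ≤ 28) (hd : ∀ x ∈ S, deg H S x ≤ 6)
    (hk : 14 ≤ #(nonisolated H S)) (h2 : ∀ x ∈ branches H S, 4 ≤ deg H S x) : Packs H S := by
  by_cases hj : ∃ v ∈ branches H S, deg H S v ≤ deg H (leaves H S) v + 3
  · obtain ⟨v, hv, hj⟩ := hj
    have hvS := (mem_branches.1 hv).1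
    have := hd v hvS
    have := h2 v hv
    exact packs_star (j := deg H S v - 3) hvS (by omega) (by omega) (by omega)
      fun U _ hUc hUv hUk => packs_of_vol_add_ten_le (by omega) (by omega) (by omega)
  push Not at hj
  obtain ⟨h3, h4⟩ := branches_bounds (s := 4) h2 fun x hx => by have := hj x hx; omega
  have h5 := card_branches_add_card_leaves (H := H) (S := S)
  rcases h4 with h0 | h4
  · have h7 := sum_branches_add_card_leaves (H := H) (S := S)
    rw [card_eq_zero.1 h0, sum_empty] at h7
    have h8 : #(leaves H S) ≤ #S := card_le_card (filter_subset _ _)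
    exact packs_of_vol_add_twelve_le (by omega)
  · omega

lemma packs_of_vol_add_six_le (h17 : 17 ≤ #S) (h18 : #S ≤ 18) (h : vol H S + 6 ≤ 2 * #S)
    (hd : ∀ x ∈ S, deg H S x ≤ 6) : Packs H S := by
  induction hn : #S using Nat.strong_induction_on generalizing S with
  | _ n ih =>
    have hd' : ∀ x, ∀ y ∈ S.erase x, deg H (S.erase x) y ≤ 6 := fun x y hy =>
      (deg_mono (erase_subset _ _) y).trans (hd y (mem_of_mem_erase hy))
    by_cases hx : ∃ x ∈ S, 2 ≤ deg H S x ∧ 4 * deg H S x + 2 ≤ #S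
    · obtain ⟨x, hx, h1, h2⟩ := hx
      have hc := card_erase_add_one hx
      have hv := vol_erase (H := H) hx
      exact (packs_of_vol_add_eight_le (by omega) (by omega) (by omega)
        (fun y hy => (hd' x y hy).trans (by norm_num)) (by omega)).of_erase hx h2
    push Not at hx
    by_cases hy : ∃ x ∈ S, deg H S x = 1
    · obtain ⟨x, hxS, h1⟩ := hy
      have hv := vol_erase (H := H) hxS
      have hv' := vol_deleteIncidenceSet (H := H) hxS
      have hc := card_erase_add_one hxS
      by_cases hi : 4 + #(nonisolated H S) ≤ #S
      · exact (packs_of_vol_add_eight_le (by omega) (by omega) (by omega) (fun y hy =>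
          ((deg_deleteIncidenceSet_le y).trans (hd y hy)).trans (by norm_num))
          (by omega)).of_deleteIncidenceSet hxS (by omega)
      by_cases hS : #S = 17
      · refine packs_seventeen hS (by omega) hd (by omega) fun x hx' => ?_
        have := hx x (mem_branches.1 hx').1 (mem_branches.1 hx').2
        omega
      · exact (ih #(S.erase x) (by omega) (by omega) (by omega) (by omega) (hd' x) rfl).of_erase
          hxS (by omega)
    push Not at hy
    have hδ : ∀ x ∈ nonisolated H S, (#S + 2) / 4 ≤ deg H S x := fun x hxn => by
      have := hx x (nonisolated_subset hxn)
      have := hy x (nonisolated_subset hxn)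
      have := (mem_nonisolated.1 hxn).2
      omega
    refine packs_of_le_deg (card_pos.1 (by omega)) hδ fun k hk hk' _ => ?_
    generalize hδ : (#S + 2) / 4 = δ at *
    have : k ≤ 7 := by
      by_contra! hcon
      have := Nat.mul_le_mul_right δ hcon
      omega
    interval_cases k <;> omega

lemma packs_eighteen_of_branches (hS : #S = 18) (hvol : vol H S ≤ 32)
    (hd : ∀ x ∈ S, deg H S x ≤ 6) (hk : 15 ≤ #(nonisolated H S))
    (h2 : ∀ x ∈ branches H S, 5 ≤ deg H S x) : Packs H S := by
  by_cases hj : ∃ v ∈ branches H S, deg H S v ≤ deg H (leaves H S) v + 3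
  · obtain ⟨v, hv, hj⟩ := hj
    have hvS := (mem_branches.1 hv).1
    have := hd v hvS
    have := h2 v hv
    exact packs_star (j := deg H S v - 3) hvS (by omega) (by omega) (by omega)
      fun U hU hUc hUv hUk => packs_of_vol_add_eight_le (by omega) (by omega) (by omega)
        (fun y hy => ((deg_mono hU y).trans (hd y (hU hy))).trans (by norm_num)) (by omega)
  push Not at hj
  obtain ⟨h3, h4⟩ := branches_bounds (s := 4) h2 fun x hx => by have := hj x hx; omega
  have h5 := card_branches_add_card_leaves (H := H) (S := S)
  rcases h4 with h0 | h4
  · have h7 := sum_branches_add_card_leaves (H := H) (S := S)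
    rw [card_eq_zero.1 h0, sum_empty] at h7
    have h8 : #(leaves H S) ≤ #S := card_le_card (filter_subset _ _)
    exact packs_of_vol_add_twelve_le (by omega)
  · omega

lemma exists_hasCoPath_nonNbrs_sum {v : V} (hv : v ∈ S) (h4 : deg H S v + 6 ≤ #S)
    (h : vol H S + 4 ≤ 2 * #S) :
    ∃ B ⊆ nonNbrs H S v, #B = 4 ∧ HasCoPath H B ∧ ∑ b ∈ B, deg H S b ≤ 6 := by
  have hA := card_nonNbrs (H := H) hv
  have hAs := sum_nonNbrs (H := H) hv
  exact exists_hasCoPath (by omega) ((filter_subset _ _).trans (erase_subset v S)) (by omega)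

lemma packs_eighteen (hS : #S = 18) (hvol : vol H S ≤ 32) (hd : ∀ x ∈ S, deg H S x ≤ 12) :
    Packs H S := by
  by_cases h8 : ∃ v ∈ S, 8 ≤ deg H S v
  · obtain ⟨v, hv, h8⟩ := h8
    have := hd v hv
    obtain ⟨B, hB, hB4, hp, hs⟩ := exists_hasCoPath_nonNbrs_sum (H := H) hv (by omega) (by omega)
    exact packs_block hv hB hB4 hp (Or.inl (by omega)) (by omega) fun U hU hUc hUv =>
      packs_of_vol_add_ten_le (by omega) (by omega) (by omega)
  push Not at h8
  by_cases h7 : ∃ v ∈ S, 7 ≤ deg H S v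
  · obtain ⟨v, hv, h7⟩ := h7
    have := hd v hv
    obtain ⟨B, hB, hB4, hp, hs⟩ := exists_hasCoPath_nonNbrs_sum (H := H) hv (by omega) (by omega)
    exact packs_block hv hB hB4 hp (Or.inl (by omega)) (by omega) fun U hU hUc hUv =>
      packs_of_vol_add_eight_le (by omega) (by omega) (by omega)
        (fun y hy => (deg_mono (hU.trans (erase_subset _ _)) y).trans
          (Nat.le_of_lt_succ (h8 y (mem_of_mem_erase (hU hy))))) (by omega)
  push Not at h7
  have hd6 : ∀ x ∈ S, deg H S x ≤ 6 := fun x hx => Nat.le_of_lt_succ (h7 x hx)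
  by_cases hx : ∃ x ∈ S, 2 ≤ deg H S x ∧ deg H S x ≤ 4
  · obtain ⟨x, hx, h1, h2⟩ := hx
    have hc := card_erase_add_one hx
    have hv := vol_erase (H := H) hx
    exact (packs_of_vol_add_six_le (by omega) (by omega) (by omega) (fun y hy =>
      (deg_mono (erase_subset _ _) y).trans (hd6 y (mem_of_mem_erase hy)))).of_erase hx (by omega)
  push Not at hx
  by_cases hy : ∃ x ∈ S, deg H S x = 1
  · obtain ⟨x, hxS, h1⟩ := hy
    have hv' := vol_deleteIncidenceSet (H := H) hxS
    by_cases hi : 4 + #(nonisolated H S) ≤ #S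
    · exact (packs_of_vol_add_six_le (by omega) (by omega) (by omega) (fun y hy =>
        (deg_deleteIncidenceSet_le y).trans (hd6 y hy))).of_deleteIncidenceSet hxS (by omega)
    · exact packs_eighteen_of_branches hS hvol hd6 (by omega) fun x hx' =>
        hx x (mem_branches.1 hx').1 (mem_branches.1 hx').2
  push Not at hy
  refine packs_of_le_deg (δ := 5) (card_pos.1 (by omega)) (fun x hxn => ?_) fun k hk hk' _ => by
    omega
  have := hx x (nonisolated_subset hxn)
  have := hy x (nonisolated_subset hxn)
  have := (mem_nonisolated.1 hxn).2
  omega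

lemma packs_of_vol_add_four_le (h18 : 18 ≤ #S) (h : vol H S + 4 ≤ 2 * #S)
    (hd : ∀ x ∈ S, deg H S x + 6 ≤ #S) : Packs H S := by
  induction hn : #S using Nat.strong_induction_on generalizing S with
  | _ n ih =>
    by_cases hS : #S = 18
    · exact packs_eighteen hS (by omega) fun x hx => by have := hd x hx; omega
    by_cases hv : ∃ v ∈ S, deg H S v + 6 = #S
    · obtain ⟨v, hv, hdv⟩ := hv
      obtain ⟨B, hB, hB4, hp, hs⟩ := exists_hasCoPath_nonNbrs_sum (H := H) hv (by omega) (by omega)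
      exact packs_block hv hB hB4 hp (Or.inl (by omega)) (by omega) fun U hU hUc hUv =>
        packs_of_vol_add_ten_le (by omega) (by omega) (by omega)
    push Not at hv
    by_cases hx : ∃ x ∈ S, 1 ≤ deg H S x ∧ 4 * deg H S x + 2 ≤ #S
    · obtain ⟨x, hx, h1, h2⟩ := hx
      have hc := card_erase_add_one hx
      have hv' := vol_erase (H := H) hx
      refine (ih #(S.erase x) (by omega) (by omega) (by omega) (fun y hy => ?_) rfl).of_erase hx h2
      have h3 := hv y (mem_of_mem_erase hy)
      have h4 := hd y (mem_of_mem_erase hy)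
      have h5 := deg_mono (H := H) (erase_subset x S) y
      omega
    push Not at hx
    refine packs_of_le_deg (card_pos.1 (by omega)) (δ := (#S + 2) / 4) (fun x hxn => ?_)
      fun k hk hk' _ => ?_
    · have := hx x (nonisolated_subset hxn) (mem_nonisolated.1 hxn).2
      omega
    · generalize hδ : (#S + 2) / 4 = δ at *
      have : k ≤ 7 := by
        by_contra! hcon
        have := Nat.mul_le_mul_right δ hcon
        omega
      interval_cases k <;> omega

lemma contains_sdiff_fromRel {W : Type*} {r : W → W → Prop} (p : V ≃ W)
    (h : ∀ x y, x ≠ y → r (p x) (p y) → H.Adj x y) :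
    Contains (⊤ \ SimpleGraph.fromRel r) Hᶜ := by
  refine ⟨p.toEmbedding, fun x y hxy => ?_⟩
  obtain ⟨hne, hxy⟩ := (SimpleGraph.compl_adj _ _ _).1 hxy
  rw [SimpleGraph.sdiff_adj, SimpleGraph.fromRel_adj, SimpleGraph.top_adj]
  refine ⟨p.injective.ne hne, ?_⟩
  rintro ⟨-, hr | hr⟩
  · exact hxy (h x y hne hr)
  · exact hxy (h y x hne.symm hr).symm

end Packing

section Graph

variable {V : Type*} [Fintype V] {H : SimpleGraph V}

lemma Packs.contains_cycleSq {n : ℕ} (hn : 5 ≤ n) (hc : #(univ : Finset V) = n)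
    (h : Packs H univ) : Contains Hᶜ (cycleSq n) := by
  obtain ⟨f, hf⟩ := h
  have : NeZero n := ⟨by omega⟩
  have key : ∀ i j, i < j → j < n → (j ≤ i + 2 ∨ n + i ≤ j + 2) → Hᶜ.Adj (f i) (f j) := by
    intro i j hij hj h
    have h1 := hf.not_adj i j hij (by rwa [hc]) (by rwa [hc])
    have h2 := hf.ne i j hij (by rwa [hc])
    exact (SimpleGraph.compl_adj _ _ _).2 ⟨h2, h1⟩
  have key' : ∀ (a b : ZMod n) (d : ℕ), 1 ≤ d → d ≤ 2 → b - a = d → Hᶜ.Adj (f a.val) (f b.val) := by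
    intro a b d hd1 hd2 hab
    have hb : b = a + d := by rw [← hab]; ring
    have ha' := ZMod.val_lt a
    have hb' := ZMod.val_lt b
    have hv : b.val = (a.val + d) % n := by
      rw [hb, ZMod.val_add, ZMod.val_natCast, Nat.add_mod_mod]
    rcases lt_or_ge (a.val + d) n with h | h
    · rw [Nat.mod_eq_of_lt h] at hv
      exact key _ _ (by omega) hb' (by omega)
    · rw [Nat.mod_eq_sub_mod h, Nat.mod_eq_of_lt (by omega)] at hv
      exact (key _ _ (by omega) ha' (by omega)).symm
  refine ⟨⟨fun a => f a.val, fun a b hab => ZMod.val_injective n ?_⟩, fun a b hab => ?_⟩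
  · exact hf.injOn _ (by rw [hc]; exact ZMod.val_lt a) _ (by rw [hc]; exact ZMod.val_lt b) hab
  · obtain ⟨-, (h | h) | h | h⟩ := (SimpleGraph.fromRel_adj _ _ _).1 hab
    · exact key' a b 1 le_rfl (by norm_num) (by simpa using h)
    · exact key' a b 2 (by norm_num) le_rfl (by simpa using h)
    · exact (key' b a 1 le_rfl (by norm_num) (by simpa using h)).symm
    · exact (key' b a 2 (by norm_num) le_rfl (by simpa using h)).symm

lemma vol_univ_add (H : SimpleGraph V) :
    vol H univ + 2 * Hᶜ.edgeSet.ncard = #(univ : Finset V) * (#(univ : Finset V) - 1) := by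
  have h1 := Hᶜ.sum_degrees_eq_twice_card_edges
  rw [← Set.ncard_coe_finset, SimpleGraph.coe_edgeFinset] at h1
  rw [← h1, vol, ← sum_add_distrib, ← smul_eq_mul, ← sum_const]
  refine sum_congr rfl fun x _ => ?_
  have h2 := H.degree_lt_card_verts x
  have h3 : deg H univ x = H.degree x := by
    rw [deg, ← H.card_neighborFinset_eq_degree]
    congr 1
    ext y
    simp
  rw [h3, SimpleGraph.degree_compl, card_univ]
  omega

lemma exists_equiv {n : ℕ} (hn : 5 ≤ n) (hV : #(univ : Finset V) = n) {v a b c d : V}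
    (h : v ∉ ({a, b, c, d} : Finset V)) (h4 : #{a, b, c, d} = 4) :
    ∃ p : V ≃ Fin n, (p v).val = 0 ∧ (p a).val = n - 4 ∧
      (p b).val = n - 3 ∧ (p c).val = n - 2 ∧ (p d).val = n - 1 := by
  obtain ⟨n1, n2, n3, n4, n5, n6⟩ := ne_of_card_four h4
  simp only [mem_insert, mem_singleton, not_or] at h
  obtain ⟨m1, m2, m3, m4⟩ := h
  have e : V ≃ Fin n := Fintype.equivFinOfCardEq hV
  have h1 : Function.Injective fun i => e (![v, a, b, c, d] i) := by
    refine e.injective.comp ?_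
    rw [← List.nodup_ofFn]
    simp [*]
  have h2 : Function.Injective ![(⟨0, by omega⟩ : Fin n), ⟨n - 4, by omega⟩, ⟨n - 3, by omega⟩,
      ⟨n - 2, by omega⟩, ⟨n - 1, by omega⟩] := by
    rw [← List.nodup_ofFn]
    simp
    omega
  obtain ⟨p, hp⟩ := Equiv.Perm.exists_extending_pair _ _ h1 h2
  refine ⟨e.trans p, ?_, ?_, ?_, ?_, ?_⟩
  · simpa using congrArg Fin.val (hp 0)
  · simpa using congrArg Fin.val (hp 1)
  · simpa using congrArg Fin.val (hp 2)
  · simpa using congrArg Fin.val (hp 3)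
  · simpa using congrArg Fin.val (hp 4)

/-- The vertices can be numbered so that `v` comes first and `a, b, c, d` come last. -/
lemma exists_labelling {n : ℕ} (hn : 5 ≤ n) (hV : #(univ : Finset V) = n) {v a b c d : V}
    (h : v ∉ ({a, b, c, d} : Finset V)) (h4 : #{a, b, c, d} = 4) :
    ∃ p : V ≃ Fin n, (∀ x, (p x).val = 0 → x = v) ∧ (∀ x, (p x).val = n - 4 ↔ x = a) ∧
      ∀ x, n - 3 ≤ (p x).val ↔ x = b ∨ x = c ∨ x = d := by
  obtain ⟨p, hv, ha, hb, hc, hd⟩ := exists_equiv hn hV h h4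
  have inj : ∀ x y, (p x).val = (p y).val → x = y := fun x y h => p.injective (Fin.ext h)
  refine ⟨p, fun x hx => inj _ _ (hx.trans hv.symm),
    fun x => ⟨fun hx => inj _ _ (hx.trans ha.symm), ?_⟩,
    fun x => ⟨fun hx => ?_, ?_⟩⟩
  · rintro rfl; exact ha
  · have := (p x).isLt
    by_cases h1 : (p x).val = n - 3
    · exact Or.inl (inj _ _ (by omega))
    by_cases h2 : (p x).val = n - 2
    · exact Or.inr (Or.inl (inj _ _ (by omega)))
    · exact Or.inr (Or.inr (inj _ _ (by omega)))
  · rintro (rfl | rfl | rfl) <;> omega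

lemma contains_knDelS {n : ℕ} (hn : 18 ≤ n) (hV : #(univ : Finset V) = n) {v : V}
    (hv : n ≤ deg H univ v + 4) : Contains (KnDelS n) Hᶜ := by
  have hA := card_nonNbrs (H := H) (mem_univ v)
  have hc := card_erase_add_one (mem_univ v)
  obtain ⟨B, hAB, hB, hB3⟩ := exists_subsuperset_card_eq (s := nonNbrs H univ v)
    (t := univ.erase v) (n := 3) (filter_subset _ _) (by omega) (by omega)
  obtain ⟨a, ha, haB⟩ := exists_mem_notMem_of_card_lt_card (by omega : #B < #(univ.erase v))
  obtain ⟨b, c, d, hbc, hbd, hcd, rfl⟩ := card_eq_three.1 hB3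
  have h4 : #{a, b, c, d} = 4 := by rw [card_insert_of_notMem haB, hB3]
  have hvB : v ∉ ({a, b, c, d} : Finset V) := fun h => (mem_insert.1 h).elim
    (fun h => ne_of_mem_erase ha h.symm) fun h => ne_of_mem_erase (hB h) rfl
  obtain ⟨p, h0, -, h3⟩ := exists_labelling (by omega) hV hvB h4
  refine contains_sdiff_fromRel p fun x y hxy hr => ?_
  obtain ⟨hx, hy, hy'⟩ := hr
  obtain rfl := h0 x hx
  by_contra hadj
  have := (h3 y).2 (by simpa using hAB (mem_nonNbrs.2 ⟨hxy.symm, mem_univ y, hadj⟩))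
  omega

lemma contains_of_deg_eq {n : ℕ} (hn : 18 ≤ n) (hV : #(univ : Finset V) = n)
    (hvol : vol H univ + 4 ≤ 2 * n) {v : V} (hv : deg H univ v + 5 = n) :
    Packs H univ ∨ Contains (KnDelSS n) Hᶜ ∨ Contains (KnDelSK n) Hᶜ := by
  have hA := card_nonNbrs (H := H) (mem_univ v)
  have hAs := sum_nonNbrs (H := H) (mem_univ v)
  have hA4 : #(nonNbrs H univ v) = 4 := by omega
  have hvA : v ∉ nonNbrs H univ v := fun h => (mem_nonNbrs.1 h).1 rfl
  have hadj : ∀ y, y ≠ v → y ∉ nonNbrs H univ v → H.Adj v y := by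
    intro y hy hyA
    by_contra h
    exact hyA (mem_nonNbrs.2 ⟨hy, mem_univ y, h⟩)
  rcases copath_or_triangle_or_claw (H := H) hA4
    ((vol_le_sum (H := H) (subset_univ _)).trans (by omega : _ ≤ 6)) with hp | hp | hp
  · refine Or.inl (packs_block (mem_univ v) Subset.rfl hA4 hp (Or.inl (by omega)) (by omega)
      fun U _ hUc hUv => packs_of_vol_add_ten_le (by omega) (by omega) (by omega))
  · obtain ⟨b, c, d, a, hB, hbc, hcd, hbd⟩ := hp
    rw [show ({b, c, d, a} : Finset V) = {a, b, c, d} by clear * -; grind] at hB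
    rw [hB] at hA4 hvA hadj
    obtain ⟨p, h0, ha, h3⟩ := exists_labelling (by omega) hV hvA hA4
    refine Or.inr (Or.inr (contains_sdiff_fromRel p fun x y hxy hr => ?_))
    rcases hr with ⟨hx, hy, hy'⟩ | ⟨hx, hy⟩
    · obtain rfl := h0 x hx
      refine hadj y hxy.symm fun hyA => ?_
      rw [mem_insert, mem_insert, mem_insert, mem_singleton, ← ha, ← h3] at hyA
      omega
    · rcases (h3 x).1 hx with rfl | rfl | rfl <;> rcases (h3 y).1 hy with rfl | rfl | rfl <;>
        first | exact (hxy rfl).elim | assumption | (apply SimpleGraph.Adj.symm; assumption)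
  · obtain ⟨a, b, c, d, hB, hab, hac, had⟩ := hp
    rw [hB] at hA4 hvA hadj
    obtain ⟨p, h0, ha, h3⟩ := exists_labelling (by omega) hV hvA hA4
    refine Or.inr (Or.inl (contains_sdiff_fromRel p fun x y hxy hr => ?_))
    rcases hr with ⟨hx, hy, hy'⟩ | ⟨hx, hy⟩
    · obtain rfl := h0 x hx
      refine hadj y hxy.symm fun hyA => ?_
      rw [mem_insert, mem_insert, mem_insert, mem_singleton, ← ha, ← h3] at hyA
      omega
    · obtain rfl := (ha x).1 hx
      rcases (h3 y).1 hy with rfl | rfl | rfl <;> assumption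

theorem contains_cycleSq_or {G : SimpleGraph V} {n : ℕ} (hn : 18 ≤ n)
    (hV : #(univ : Finset V) = n) (he : n ^ 2 + 4 ≤ 2 * G.edgeSet.ncard + 3 * n) :
    Contains G (cycleSq n) ∨
      Contains (KnDelS n) G ∨ Contains (KnDelSS n) G ∨ Contains (KnDelSK n) G := by
  obtain ⟨H, rfl⟩ : ∃ H, G = Hᶜ := ⟨Gᶜ, (compl_compl G).symm⟩
  have hvol : vol H univ + 4 ≤ 2 * n := by
    have h1 := vol_univ_add H
    obtain ⟨k, rfl⟩ : ∃ k, n = k + 1 := ⟨n - 1, by omega⟩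
    rw [hV, Nat.add_sub_cancel] at h1
    nlinarith
  by_cases h4 : ∃ v, n ≤ deg H univ v + 4
  · obtain ⟨v, hv⟩ := h4
    exact Or.inr (Or.inl (contains_knDelS hn hV hv))
  push Not at h4
  by_cases h5 : ∃ v, deg H univ v + 5 = n
  · obtain ⟨v, hv⟩ := h5
    rcases contains_of_deg_eq hn hV hvol hv with h | h
    · exact Or.inl (h.contains_cycleSq (by omega) hV)
    · exact Or.inr (Or.inr h)
  push Not at h5
  refine Or.inl (Packs.contains_cycleSq (by omega) hV
    (packs_of_vol_add_four_le (by omega) (by omega) fun x _ => ?_))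
  have := h4 x
  have := h5 x
  omega

end Graph

end CycleSquare

/-- Let `G` be a simple graph on `n ≥ 18` vertices. If
`e(G) > (n² − 3n + 3)/2`, then `G` contains the 2-power of a Hamilton cycle, unless `G` is a
subgraph of one of `K_n \ E(S_{n−3})`, `K_n \ E(S_{n−4} ∪ S_4)`, `K_n \ E(S_{n−4} ∪ K_3)`. -/
theorem stmt0 (n : ℕ) (hn : 18 ≤ n) (G : SimpleGraph (Fin n))
    (he : ((n : ℝ) ^ 2 - 3 * n + 3) / 2 < (G.edgeSet.ncard : ℝ)) :
    Contains G (cycleSq n) ∨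
      Contains (KnDelS n) G ∨ Contains (KnDelSS n) G ∨ Contains (KnDelSK n) G := by
  refine CycleSquare.contains_cycleSq_or hn (by simp) ?_
  have : (n : ℝ) ^ 2 + 3 < 2 * (G.edgeSet.ncard : ℝ) + 3 * n := by linarith
  exact_mod_cast this
end

section
/- Let G be a simple graph on n ≥ 18 vertices and let μ denote spectral radius. If μ(G) ≥ μ(K_n \ E(S_{n−3})), then G contains the 2-power of a Hamilton cycle, unless G = K_n \ E(S_{n−3}). -/
/-- The spectral radius of a finite graph: the largest (real) eigenvalue of its
adjacency matrix, expressed as the supremum of the real spectrum. -/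
noncomputable def specRad {V : Type*} [Fintype V] [DecidableEq V] (G : SimpleGraph V) : ℝ :=
  letI := Classical.decRel G.Adj
  sSup (spectrum ℝ (G.adjMatrix ℝ))

/-- A square cycle of length `m` on vertices of `T`, given by an `m`-periodic enumeration. -/
def HasSqCycle {V : Type*} (G : SimpleGraph V) (T : Finset V) (m : ℕ) : Prop :=
  ∃ f : ℕ → V, (∀ i j, f i = f j ↔ i ≡ j [MOD m]) ∧ (∀ i, f i ∈ T) ∧
    (∀ i, G.Adj (f i) (f (i + 1))) ∧ ∀ i, G.Adj (f i) (f (i + 2))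

section SquareCycle

variable {V : Type*} {G : SimpleGraph V}

lemma hasSqCycle_of_isClique {T : Finset V} (hT : G.IsClique T) (h3 : 3 ≤ T.card) :
    HasSqCycle G T T.card := by
  have hpos : 0 < T.card := by omega
  let e := T.equivFin.symm
  let f : ℕ → V := fun i => e ⟨i % T.card, Nat.mod_lt _ hpos⟩
  have hinj : ∀ i j, f i = f j ↔ i ≡ j [MOD T.card] := by
    intro i j
    simp only [f, Subtype.coe_inj, e.injective.eq_iff, Fin.mk.injEq]
    rfl
  have hmem : ∀ i, f i ∈ T := fun i => (e _).2
  have key : ∀ i s, 0 < s → s < T.card → G.Adj (f i) (f (i + s)) := by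
    intro i s hs hs'
    refine hT (hmem _) (hmem _) fun h => ?_
    have h1 := (hinj _ _).1 h
    have h2 : 0 ≡ s [MOD T.card] := by
      have : i + 0 ≡ i + s [MOD T.card] := h1
      exact Nat.ModEq.add_left_cancel' i this
    rw [Nat.ModEq, Nat.zero_mod, Nat.mod_eq_of_lt hs'] at h2
    omega
  exact ⟨f, hinj, hmem, fun i => key i 1 (by omega) (by omega), fun i => key i 2 (by omega) (by omega)⟩

lemma hasSqCycle_insert_last [DecidableEq V] {T : Finset V} {m : ℕ} (hm : 3 ≤ m)
    {w : V} (hw : w ∉ T) {f : ℕ → V}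
    (hf : ∀ i j, f i = f j ↔ i ≡ j [MOD m]) (hfT : ∀ i, f i ∈ T)
    (h1 : ∀ i, G.Adj (f i) (f (i + 1))) (h2 : ∀ i, G.Adj (f i) (f (i + 2)))
    (ha : G.Adj w (f (m - 2))) (hb : G.Adj w (f (m - 1)))
    (hc : G.Adj w (f 0)) (hd : G.Adj w (f 1)) :
    HasSqCycle G (insert w T) (m + 1) := by
  have hper : ∀ i, f (i + m) = f i := fun i => (hf _ _).2 (by simp [Nat.ModEq])
  have hlt : ∀ i, i % (m + 1) < m + 1 := fun i => Nat.mod_lt _ (by omega)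
  refine ⟨fun i => if i % (m + 1) = m then w else f (i % (m + 1)), ?_, ?_, ?_, ?_⟩
  · intro i j
    have hi := hlt i
    have hj := hlt j
    dsimp only [Nat.ModEq]
    generalize i % (m + 1) = a at *
    generalize j % (m + 1) = b at *
    have hwf : ∀ i, w ≠ f i := fun i h => hw (h ▸ hfT i)
    split_ifs with p q q
    · simp [p, q]
    · simp only [hwf, false_iff]; omega
    · simp only [(hwf _).symm, false_iff]; omega
    · rw [hf, Nat.ModEq, Nat.mod_eq_of_lt (by omega), Nat.mod_eq_of_lt (by omega)]
  · intro i
    dsimp only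
    split_ifs
    · simp
    · exact Finset.mem_insert_of_mem (hfT _)
  · intro i
    have hi := hlt i
    dsimp only
    rw [Nat.add_mod i 1, Nat.mod_eq_of_lt (a := 1) (by omega)]
    generalize i % (m + 1) = a at *
    rcases (by omega : a = m ∨ a = m - 1 ∨ a + 1 < m) with rfl | rfl | h
    · simpa [show a ≠ 0 by omega, show (0 : ℕ) ≠ a by omega] using hc
    · rw [show m - 1 + 1 = m by omega, Nat.mod_eq_of_lt (a := m) (by omega)]
      simpa [show m - 1 ≠ m by omega] using hb.symm
    · rw [Nat.mod_eq_of_lt (by omega), if_neg (by omega), if_neg (by omega)]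
      exact h1 a
  · intro i
    have hi := hlt i
    dsimp only
    rw [Nat.add_mod i 2, Nat.mod_eq_of_lt (a := 2) (by omega)]
    generalize i % (m + 1) = a at *
    rcases (by omega : a = m ∨ a = m - 1 ∨ a = m - 2 ∨ a + 2 < m) with rfl | rfl | rfl | h
    · rw [if_pos rfl, show a + 2 = 1 + (a + 1) by omega, Nat.add_mod_right,
        Nat.mod_eq_of_lt (by omega), if_neg (by omega)]
      exact hd
    · rw [if_neg (by omega), show m - 1 + 2 = 0 + (m + 1) by omega, Nat.add_mod_right,
        Nat.mod_eq_of_lt (by omega), if_neg (by omega)]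
      have := h1 (m - 1)
      rwa [show m - 1 + 1 = 0 + m by omega, hper] at this
    · rw [show m - 2 + 2 = m by omega, Nat.mod_eq_of_lt (a := m) (by omega)]
      simpa [show m - 2 ≠ m by omega] using ha.symm
    · rw [Nat.mod_eq_of_lt (by omega), if_neg (by omega), if_neg (by omega)]
      exact h2 a

/-- A vertex with few non-neighbours on a square cycle fits into one of its gaps. -/
lemma HasSqCycle.insert_of_card_lt [DecidableEq V] {H : SimpleGraph V} [DecidableRel H.Adj]
    {T : Finset V} {m : ℕ} (hm : 3 ≤ m) (h : HasSqCycle Hᶜ T m) {w : V} (hw : w ∉ T)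
    (hd : 4 * (T.filter (H.Adj w)).card < m) :
    HasSqCycle Hᶜ (insert w T) (m + 1) := by
  obtain ⟨f, hf, hfT, h1, h2⟩ := h
  obtain ⟨r, hr, hgap⟩ : ∃ r ∈ Finset.range m, ∀ s ∈ Finset.range 4, ¬ H.Adj w (f (r + s)) := by
    by_contra! hcon
    have hsub : Finset.range m ⊆ (Finset.range 4).biUnion
        fun s => (Finset.range m).filter fun r => H.Adj w (f (r + s)) := by
      intro r hr
      obtain ⟨s, hs, hs'⟩ := hcon r hr
      exact Finset.mem_biUnion.2 ⟨s, hs, Finset.mem_filter.2 ⟨hr, hs'⟩⟩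
    have hcard := (Finset.card_le_card hsub).trans (Finset.card_biUnion_le_card_mul _ _
      (T.filter (H.Adj w)).card fun s _ => ?_)
    · simp only [Finset.card_range] at hcard
      omega
    · refine Finset.card_le_card_of_injOn (fun r => f (r + s)) ?_ ?_
      · intro r hr
        simp only [Finset.coe_filter, Set.mem_ofPred_eq] at hr ⊢
        exact ⟨hfT _, hr.2⟩
      · intro a ha b hb hab
        simp only [Finset.coe_filter, Set.mem_ofPred_eq, Finset.mem_range] at ha hb
        have := Nat.ModEq.add_right_cancel' s ((hf _ _).1 hab)
        rwa [Nat.ModEq, Nat.mod_eq_of_lt ha.1, Nat.mod_eq_of_lt hb.1] at this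
  have hper : ∀ i, f (i + m) = f i := fun i => (hf _ _).2 (by simp [Nat.ModEq])
  have hadj : ∀ s < 4, Hᶜ.Adj w (f (r + s)) := fun s hs =>
    ⟨fun h => hw (h ▸ hfT _), hgap s (Finset.mem_range.2 hs)⟩
  refine hasSqCycle_insert_last hm hw (f := fun i => f (i + (r + 2))) ?_
    (fun i => hfT _) ?_ ?_ ?_ ?_ ?_ ?_
  · intro i j
    rw [hf]
    exact ⟨Nat.ModEq.add_right_cancel' _, Nat.ModEq.add_right _⟩
  · intro i
    have := h1 (i + (r + 2))
    rwa [show i + (r + 2) + 1 = i + 1 + (r + 2) by ring] at this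
  · intro i
    have := h2 (i + (r + 2))
    rwa [show i + (r + 2) + 2 = i + 2 + (r + 2) by ring] at this
  · have := hadj 0 (by omega)
    rwa [← hper, show r + 0 + m = m - 2 + (r + 2) by omega] at this
  · have := hadj 1 (by omega)
    rwa [← hper, show r + 1 + m = m - 1 + (r + 2) by omega] at this
  · simpa using hadj 2 (by omega)
  · have := hadj 3 (by omega)
    rwa [show r + 3 = 1 + (r + 2) by omega] at this


variable (H : SimpleGraph V) [DecidableRel H.Adj]

/-- Number of `H`-neighbours of `w` in `S`. -/
def degIn (S : Finset V) (w : V) : ℕ := (S.filter (H.Adj w)).card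

variable {H}

lemma degIn_mono {S T : Finset V} (h : S ⊆ T) (w : V) : degIn H S w ≤ degIn H T w :=
  Finset.card_le_card (Finset.filter_subset_filter _ h)

lemma degIn_erase_add [DecidableEq V] {S : Finset V} {w : V} (hw : w ∈ S) (u : V) :
    degIn H (S.erase w) u + (if H.Adj u w then 1 else 0) = degIn H S u := by
  simp only [degIn, Finset.card_filter]
  exact Finset.sum_erase_add _ _ hw

lemma degIn_self_erase [DecidableEq V] (S : Finset V) (w : V) :
    degIn H (S.erase w) w = degIn H S w := by
  by_cases hw : w ∈ S
  · simpa using degIn_erase_add (H := H) hw w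
  · rw [Finset.erase_eq_of_notMem hw]

lemma sum_degIn_erase_add [DecidableEq V] {S : Finset V} {w : V} (hw : w ∈ S) :
    ∑ u ∈ S.erase w, degIn H (S.erase w) u + 2 * degIn H S w = ∑ u ∈ S, degIn H S u := by
  rw [← Finset.sum_erase_add _ _ hw,
    ← Finset.sum_congr rfl fun u _ => degIn_erase_add (H := H) hw u, Finset.sum_add_distrib]
  have : ∑ u ∈ S.erase w, (if H.Adj u w then 1 else 0) = degIn H S w := by
    rw [← degIn_self_erase, degIn, Finset.card_filter]
    simp only [H.adj_comm w]
  omega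

/-- A vertex of least positive degree `d` forces at least `d (d + 1)` incidences. -/
lemma exists_degIn_mul_le {S : Finset V} (h : ∑ u ∈ S, degIn H S u ≠ 0) :
    ∃ w ∈ S, 0 < degIn H S w ∧ degIn H S w * (degIn H S w + 1) ≤ ∑ u ∈ S, degIn H S u := by
  classical
  obtain ⟨u, hu, hu0⟩ := Finset.exists_ne_zero_of_sum_ne_zero h
  obtain ⟨w, hw, hmin⟩ := (S.filter fun u => 0 < degIn H S u).exists_min_image (degIn H S)
    ⟨u, Finset.mem_filter.2 ⟨hu, Nat.pos_of_ne_zero hu0⟩⟩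
  obtain ⟨hwS, hw0⟩ := Finset.mem_filter.1 hw
  refine ⟨w, hwS, hw0, ?_⟩
  have hnot : w ∉ S.filter (H.Adj w) := by simp
  have hsub : insert w (S.filter (H.Adj w)) ⊆ S :=
    Finset.insert_subset hwS (Finset.filter_subset _ _)
  calc degIn H S w * (degIn H S w + 1)
      = ∑ _u ∈ insert w (S.filter (H.Adj w)), degIn H S w := by
        rw [Finset.sum_const, Finset.card_insert_of_notMem hnot, smul_eq_mul, mul_comm]; rfl
    _ ≤ ∑ u ∈ insert w (S.filter (H.Adj w)), degIn H S u := by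
        refine Finset.sum_le_sum fun u hu => ?_
        rcases Finset.mem_insert.1 hu with rfl | hu
        · rfl
        · obtain ⟨huS, huw⟩ := Finset.mem_filter.1 hu
          refine hmin u (Finset.mem_filter.2 ⟨huS, Finset.card_pos.2 ⟨w, ?_⟩⟩)
          exact Finset.mem_filter.2 ⟨hwS, huw.symm⟩
    _ ≤ _ := Finset.sum_le_sum_of_subset hsub

/-- Greedy insertion: if `v` has many non-neighbours compared with the number of edges of `H`
avoiding `v`, and there are few such edges, then the complement of `H` has a spanning square
cycle. -/
theorem hasSqCycle_of_sparse [DecidableEq V] (v : V) (c D : ℕ)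
    (hcD : ∀ d, 1 ≤ d → 8 * min (d + 1) D + 4 ≤ 2 * c + d * (d + 1)) (S P : Finset V)
    (hv : v ∉ S) (hPS : P ⊆ S) (hPv : ∀ u ∈ P, ¬ H.Adj v u)
    (hD : ∀ u ∈ S, degIn H (insert v S) u ≤ D)
    (hP : 8 + ∑ u ∈ S, degIn H S u ≤ 2 * P.card)
    (hS : ∑ u ∈ S, degIn H S u ≠ 0 → 2 * c + ∑ u ∈ S, degIn H S u ≤ 2 * (S.card + 1)) :
    HasSqCycle Hᶜ (insert v S) (S.card + 1) := by
  induction hm : S.card generalizing S P with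
  | zero =>
    have := Finset.card_le_card hPS
    omega
  | succ m ih =>
    have hPcard := Finset.card_le_card hPS
    have step : ∀ w ∈ S, 4 * min (degIn H S w + 1) D < m + 1 →
        (∃ Q ⊆ P, w ∉ Q ∧ 8 + ∑ u ∈ S, degIn H S u ≤ 2 * Q.card + 2 * degIn H S w) →
        (∑ u ∈ S, degIn H S u ≠ 0 → 0 < degIn H S w) →
        HasSqCycle Hᶜ (insert v S) (m + 1 + 1) := by
      rintro w hw hdeg ⟨Q, hQP, hwQ, hQ⟩ hpos
      have hwv : w ≠ v := fun h => hv (h ▸ hw)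
      have hsum := sum_degIn_erase_add (H := H) hw
      have hcard := Finset.card_erase_of_mem hw
      have hQS : Q ⊆ S.erase w := fun u hu =>
        Finset.mem_erase.2 ⟨fun h => hwQ (h ▸ hu), hPS (hQP hu)⟩
      have hQcard := Finset.card_le_card hQS
      have hsub : insert v (S.erase w) ⊆ insert v S :=
        Finset.insert_subset_insert v (Finset.erase_subset w S)
      have hrec := ih (S.erase w) Q (fun h => hv (Finset.mem_of_mem_erase h)) hQS
        (fun u hu => hPv u (hQP hu))
        (fun u hu => (degIn_mono hsub u).trans (hD u (Finset.mem_of_mem_erase hu)))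
        (by omega) (by omega) (by omega)
      have hins := hrec.insert_of_card_lt (w := w) (by omega) (by simp [hwv]) (by
        have h1 : degIn H (insert v (S.erase w)) w ≤ degIn H S w + 1 := by
          rw [← degIn_self_erase S]
          refine (Finset.card_le_card ?_).trans (Finset.card_insert_le v _)
          intro u
          simp only [Finset.mem_filter, Finset.mem_insert]
          tauto
        have h2 := (degIn_mono hsub w).trans (hD w hw)
        have h3 := le_min h1 h2
        rw [degIn] at h3
        omega)
      rwa [Finset.insert_comm, Finset.insert_erase hw] at hins
    by_cases hE : ∑ u ∈ S, degIn H S u = 0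
    · have hzero : ∀ u ∈ S, degIn H S u = 0 := Finset.sum_eq_zero_iff.1 hE
      by_cases hm4 : m = 3
      · have hPS' : P = S := Finset.eq_of_subset_of_card_le hPS (by omega)
        have hclique : Hᶜ.IsClique (insert v S : Finset V) := by
          have hSS : ∀ a ∈ S, ∀ b ∈ S, ¬ H.Adj a b := by
            intro a ha b hb hab
            have := Finset.card_eq_zero.1 (hzero a ha)
            exact Finset.notMem_empty b (this ▸ Finset.mem_filter.2 ⟨hb, hab⟩)
          rw [hPS'] at hPv
          intro a ha b hb hab
          refine ⟨hab, fun h => ?_⟩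
          simp only [Finset.coe_insert, Set.mem_insert_iff, Finset.mem_coe] at ha hb
          rcases ha with rfl | ha <;> rcases hb with rfl | hb
          · exact hab rfl
          · exact hPv b hb h
          · exact hPv a ha h.symm
          · exact hSS a ha b hb h
        have := hasSqCycle_of_isClique hclique (by rw [Finset.card_insert_of_notMem hv]; omega)
        rwa [Finset.card_insert_of_notMem hv, hm] at this
      · obtain ⟨Q, hQP, hQ4⟩ := Finset.exists_subset_card_eq (show 4 ≤ P.card by omega)
        obtain ⟨w, hw, hwQ⟩ := Finset.exists_mem_notMem_of_card_lt_card
          (show Q.card < S.card by omega)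
        have hw0 := hzero w hw
        exact step w hw (by omega) ⟨Q, hQP, hwQ, by omega⟩ (fun h => absurd hE h)
    · obtain ⟨w, hw, hpos, hle⟩ := exists_degIn_mul_le hE
      have hdD := hcD _ hpos
      have hS' := hS hE
      refine step w hw (by omega) ⟨P.erase w, Finset.erase_subset _ _, by simp, ?_⟩ (fun _ => hpos)
      have := Finset.pred_card_le_card_erase (s := P) (a := w)
      omega

end SquareCycle

section Spectral

variable {V : Type*} [Fintype V] [DecidableEq V]

open scoped Classical in
lemma specRad_mem_spectrum [Nonempty V] (G : SimpleGraph V) :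
    specRad G ∈ spectrum ℝ (G.adjMatrix ℝ) := by
  have hA : (G.adjMatrix ℝ).IsHermitian := by
    simp [Matrix.IsHermitian, Matrix.conjTranspose_eq_transpose_of_trivial]
  have hne : (spectrum ℝ (G.adjMatrix ℝ)).Nonempty := by
    rw [hA.spectrum_real_eq_range_eigenvalues]
    exact Set.range_nonempty _
  exact hne.csSup_mem Matrix.finite_real_spectrum

open scoped Classical in
lemma posSemidef_specRad_sub (G : SimpleGraph V) :
    (algebraMap ℝ (Matrix V V ℝ) (specRad G) - G.adjMatrix ℝ).PosSemidef := by
  rw [Matrix.posSemidef_iff_isHermitian_and_spectrum_nonneg]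
  constructor
  · simp [Matrix.IsHermitian, Matrix.conjTranspose_eq_transpose_of_trivial,
      Matrix.algebraMap_eq_diagonal]
  · rw [← spectrum.singleton_sub_eq]
    rintro _ ⟨_, rfl, s, hs, rfl⟩
    have : s ≤ specRad G := le_csSup Matrix.finite_real_spectrum.bddAbove hs
    simpa using this

/-- The quadratic form of the adjacency matrix. -/
noncomputable def adjForm (G : SimpleGraph V) (x : V → ℝ) : ℝ :=
  open scoped Classical in ∑ i, ∑ j, if G.Adj i j then x i * x j else 0

open scoped Classical in
lemma dotProduct_specRad_sub_mulVec (G : SimpleGraph V) (x : V → ℝ) :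
    x ⬝ᵥ ((algebraMap ℝ (Matrix V V ℝ) (specRad G) - G.adjMatrix ℝ).mulVec x) =
      specRad G * ∑ i, x i ^ 2 - adjForm G x := by
  rw [Matrix.sub_mulVec, dotProduct_sub]
  congr 1
  · rw [Matrix.algebraMap_eq_diagonal]
    simp only [dotProduct, Matrix.mulVec_diagonal, Finset.mul_sum]
    exact Finset.sum_congr rfl fun i _ => by simp; ring
  · simp only [dotProduct, Matrix.mulVec, Finset.mul_sum, adjForm, SimpleGraph.adjMatrix_apply]
    exact Finset.sum_congr rfl fun i _ => Finset.sum_congr rfl fun j _ => by split_ifs <;> simp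

lemma adjForm_le (G : SimpleGraph V) (x : V → ℝ) : adjForm G x ≤ specRad G * ∑ i, x i ^ 2 := by
  classical
  have := (posSemidef_specRad_sub G).dotProduct_mulVec_nonneg x
  rw [star_trivial, dotProduct_specRad_sub_mulVec] at this
  linarith

open scoped Classical in
/-- Vectors attaining the maximum of the Rayleigh quotient are eigenvectors. -/
lemma sum_adj_eq_of_le_adjForm {G : SimpleGraph V} {x : V → ℝ}
    (h : specRad G * ∑ i, x i ^ 2 ≤ adjForm G x) (i : V) :
    ∑ j, (if G.Adj i j then x j else 0) = specRad G * x i := by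
  have h0 := ((posSemidef_specRad_sub G).dotProduct_mulVec_zero_iff x).1 (by
    rw [star_trivial, dotProduct_specRad_sub_mulVec]
    linarith [adjForm_le G x])
  have := congrFun h0 i
  rw [Matrix.sub_mulVec, Algebra.algebraMap_eq_smul_one, Matrix.smul_mulVec,
    Matrix.one_mulVec] at this
  simp only [Pi.sub_apply, Pi.smul_apply, smul_eq_mul, Matrix.mulVec, dotProduct,
    SimpleGraph.adjMatrix_apply, Pi.zero_apply, ite_mul, one_mul, zero_mul] at this
  linarith

lemma exists_perron [Nonempty V] (G : SimpleGraph V) :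
    ∃ x : V → ℝ, (∀ i, 0 ≤ x i) ∧ x ≠ 0 ∧ specRad G * ∑ i, x i ^ 2 ≤ adjForm G x := by
  classical
  have hmem := specRad_mem_spectrum G
  rw [← Matrix.spectrum_toLin', ← Module.End.hasEigenvalue_iff_mem_spectrum] at hmem
  obtain ⟨x, hx⟩ := hmem.exists_hasEigenvector
  refine ⟨fun i => |x i|, fun i => abs_nonneg _, ?_, ?_⟩
  · intro h
    exact hx.2 (funext fun i => abs_eq_zero.1 (congrFun h i))
  · have h1 : adjForm G x = specRad G * ∑ i, x i ^ 2 := by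
      have h2 : (G.adjMatrix ℝ).mulVec x = specRad G • x := by
        simpa using hx.apply_eq_smul
      have h3 := dotProduct_specRad_sub_mulVec G x
      rw [Matrix.sub_mulVec, h2, Algebra.algebraMap_eq_smul_one, Matrix.smul_mulVec,
        Matrix.one_mulVec, sub_self, dotProduct_zero] at h3
      linarith
    simp only [sq_abs]
    rw [← h1]
    refine Finset.sum_le_sum fun i _ => Finset.sum_le_sum fun j _ => ?_
    split_ifs
    · rw [← abs_mul]; exact le_abs_self _
    · rfl

open scoped Classical in
/-- A lower bound on the spectral radius bounds a degree sum of the complement. -/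
lemma sum_compl_degree_mul_le (G : SimpleGraph V) {N : ℝ} (hN : 1 ≤ N)
    (hcard : (Fintype.card V : ℝ) = N + 1) (hG : N - 1 + 9 / N ^ 2 ≤ specRad G) :
    ∑ i, (Gᶜ.degree i : ℝ) * (N - Gᶜ.degree i) ≤ N ^ 2 - 9 * (N - 1) / N := by
  have : Nonempty V := Fintype.card_pos_iff.1 (by
    have : (0 : ℝ) < Fintype.card V := by linarith
    exact_mod_cast this)
  obtain ⟨x, hx, hx0, hmax⟩ := exists_perron G
  have heig := sum_adj_eq_of_le_adjForm hmax
  set s := ∑ i, x i with hs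
  set M := specRad G + 1 with hM
  set h : V → ℝ := fun i => (Gᶜ.degree i : ℝ) with hh
  have hspos : 0 < s := by
    obtain ⟨i, hi⟩ := Function.ne_iff.1 hx0
    exact Finset.sum_pos' (fun i _ => hx i) ⟨i, Finset.mem_univ i, (hx i).lt_of_ne' hi⟩
  have hδ : 0 ≤ 9 / N ^ 2 := by positivity
  have hMN : N ≤ M := by linarith
  have hMpos : 0 < M := by linarith
  have hcompl : ∀ i, M * x i = s - ∑ j, (if Gᶜ.Adj i j then x j else 0) := by
    intro i
    have h1 : s = ∑ j, ((if G.Adj i j then x j else 0) + (if Gᶜ.Adj i j then x j else 0) +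
        if i = j then x j else 0) := by
      refine Finset.sum_congr rfl fun j _ => ?_
      by_cases hij : i = j
      · subst hij; simp
      · by_cases hadj : G.Adj i j <;> simp [hij, hadj]
    rw [Finset.sum_add_distrib, Finset.sum_add_distrib, heig i] at h1
    simp only [Finset.sum_ite_eq, Finset.mem_univ, if_true] at h1
    linarith
  have hub : ∀ i, M * x i ≤ s := fun i => by
    rw [hcompl i]
    have : 0 ≤ ∑ j, (if Gᶜ.Adj i j then x j else 0) :=
      Finset.sum_nonneg fun j _ => by split_ifs <;> simp [hx]
    linarith
  have hdeg : ∀ i, ∑ j, (if Gᶜ.Adj i j then (1 : ℝ) else 0) = h i := by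
    intro i
    simp [hh, ← SimpleGraph.card_neighborFinset_eq_degree, SimpleGraph.neighborFinset_eq_filter]
  have hlb : ∀ i, M * s - h i * s ≤ M ^ 2 * x i := by
    intro i
    have h1 : M * ∑ j, (if Gᶜ.Adj i j then x j else 0) ≤ h i * s := by
      rw [← hdeg, Finset.sum_mul, Finset.mul_sum]
      refine Finset.sum_le_sum fun j _ => ?_
      split_ifs
      · simpa using hub j
      · simp
    have := hcompl i
    nlinarith
  have htot : ∑ i, h i * x i = (N + 1 - M) * s := by
    have h1 : M * s = ∑ i, (s - ∑ j, (if Gᶜ.Adj i j then x j else 0)) := by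
      rw [hs, Finset.mul_sum]
      exact Finset.sum_congr rfl fun i _ => hcompl i
    rw [Finset.sum_sub_distrib, Finset.sum_const, Finset.card_univ, nsmul_eq_mul, hcard,
      Finset.sum_comm] at h1
    have h2 : ∑ j, ∑ i, (if Gᶜ.Adj i j then x j else 0) = ∑ j, h j * x j := by
      refine Finset.sum_congr rfl fun j _ => ?_
      rw [← hdeg, Finset.sum_mul]
      exact Finset.sum_congr rfl fun i _ => by simp [Gᶜ.adj_comm i j]
    rw [h2] at h1
    linarith
  have hM2 : ∑ i, h i * (M - h i) ≤ (N + 1 - M) * M ^ 2 := by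
    have h1 : (∑ i, h i * (M - h i)) * s ≤ ((N + 1 - M) * M ^ 2) * s := by
      rw [mul_right_comm, ← htot, Finset.sum_mul, Finset.sum_mul]
      refine Finset.sum_le_sum fun i _ => ?_
      have : 0 ≤ h i := by positivity
      nlinarith [mul_le_mul_of_nonneg_left (hlb i) this]
    exact le_of_mul_le_mul_right h1 hspos
  have hscale : M * ∑ i, h i * (N - h i) ≤ N * ∑ i, h i * (M - h i) := by
    rw [Finset.mul_sum, Finset.mul_sum]
    refine Finset.sum_le_sum fun i _ => ?_
    nlinarith [mul_nonneg (sub_nonneg.2 hMN) (mul_self_nonneg (h i))]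
  have hle : ∑ i, h i * (N - h i) ≤ N * ((N + 1 - M) * M) := by
    refine le_of_mul_le_mul_left (hscale.trans ?_) hMpos
    calc N * ∑ i, h i * (M - h i) ≤ N * ((N + 1 - M) * M ^ 2) := by gcongr
      _ = _ := by ring
  refine hle.trans ?_
  have h9 : 9 * (N - 1) / N = N * ((N - 1) * (9 / N ^ 2)) := by field_simp
  rw [h9]
  have : (N + 1 - M) * M ≤ N - (N - 1) * (9 / N ^ 2) := by
    have h1 : 9 / N ^ 2 ≤ M - N := by linarith
    nlinarith [mul_le_mul_of_nonneg_left h1 (sub_nonneg.2 hN), sq_nonneg (M - N)]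
  nlinarith

lemma KnDelS_adj {n : ℕ} {u v : Fin n} : (KnDelS n).Adj u v ↔
    u ≠ v ∧ (u.val = 0 → n ≤ v.val + 3) ∧ (v.val = 0 → n ≤ u.val + 3) := by
  have hu := u.isLt
  have hv := v.isLt
  simp only [KnDelS, SimpleGraph.sdiff_adj, SimpleGraph.top_adj, SimpleGraph.fromRel_adj, ne_eq,
    Fin.ext_iff]
  omega

/-- `KnDelS n` has spectral radius slightly above `n - 2`. -/
lemma le_specRad_KnDelS {n : ℕ} (hn : 5 ≤ n) {N : ℝ} (hN : (n : ℝ) = N + 1) :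
    N - 1 + 9 / N ^ 2 ≤ specRad (KnDelS n) := by
  classical
  obtain ⟨p, rfl⟩ : ∃ p, n = p + 3 + 1 := ⟨n - 4, by omega⟩
  have hNp : N = p + 3 := by push_cast at hN; linarith
  have hp : (1 : ℝ) ≤ p := by exact_mod_cast (by omega : 1 ≤ p)
  set ε : ℝ := 3 / (N - 1) with hε
  have hN1 : 0 < N - 1 := by linarith
  have hεN : (N - 1) * ε = 3 := by rw [hε]; field_simp
  let y : Fin (p + 3 + 1) → ℝ := Fin.cons ε fun _ => 1
  have hcount : ∑ j : Fin (p + 3), (if p ≤ j.val then ε else 0) = 3 * ε := by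
    rw [Fin.sum_univ_castSucc, Fin.sum_univ_castSucc, Fin.sum_univ_castSucc,
      Finset.sum_eq_zero fun j _ => if_neg (by simp)]
    simp
    ring
  have hsq : ∑ i, y i ^ 2 = N + ε ^ 2 := by
    rw [Fin.sum_univ_succ]
    simp [y, hNp]
    ring
  have hform : adjForm (KnDelS (p + 3 + 1)) y = N * (N - 1) + 6 * ε := by
    have hrow : ∀ i : Fin (p + 3), ∑ j : Fin (p + 3), (if i = j then (0 : ℝ) else 1) = N - 1 := by
      intro i
      have : ∀ j : Fin (p + 3), (if i = j then (0 : ℝ) else 1) = 1 - if i = j then 1 else 0 := by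
        intro j; split_ifs <;> simp
      simp [this, hNp]
    have h0s : ∀ j : Fin (p + 3), (KnDelS (p + 3 + 1)).Adj 0 j.succ ↔ p ≤ j.val := by
      intro j
      simp only [KnDelS_adj, Fin.val_succ, Fin.val_zero, ne_eq, Fin.ext_iff, true_imp_iff]
      omega
    have hss : ∀ i j : Fin (p + 3), (KnDelS (p + 3 + 1)).Adj i.succ j.succ ↔ ¬ i = j := by
      intro i j
      simp only [KnDelS_adj, Fin.val_succ, ne_eq, Fin.ext_iff]
      omega
    have hs0 : ∀ j : Fin (p + 3), (KnDelS (p + 3 + 1)).Adj j.succ 0 ↔ p ≤ j.val := fun j => by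
      rw [SimpleGraph.adj_comm, h0s]
    simp only [adjForm, Fin.sum_univ_succ (n := p + 3), y, Fin.cons_zero, Fin.cons_succ, h0s, hss,
      hs0, SimpleGraph.irrefl, if_false, mul_one, one_mul, ite_not, hcount, Finset.sum_add_distrib,
      hrow, Finset.sum_const, Finset.card_univ, Fintype.card_fin, nsmul_eq_mul, hNp]
    push_cast
    ring
  have hmax := adjForm_le (KnDelS (p + 3 + 1)) y
  rw [hsq, hform] at hmax
  have hNpos : 0 < N := by linarith
  refine le_of_mul_le_mul_right (le_trans ?_ hmax) (show 0 < N + ε ^ 2 by positivity)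
  have h1 : N + ε ^ 2 ≤ N ^ 2 / (N - 1) := by
    rw [le_div_iff₀ hN1]
    nlinarith
  have h2 : 9 / N ^ 2 * (N + ε ^ 2) ≤ 3 * ε := by
    calc 9 / N ^ 2 * (N + ε ^ 2) ≤ 9 / N ^ 2 * (N ^ 2 / (N - 1)) := by gcongr
      _ = 3 * ε := by rw [hε]; field_simp; norm_num
  have h3 : (N - 1) * ε ^ 2 = 3 * ε := by rw [pow_two, ← mul_assoc, hεN]
  nlinarith

end Spectral

lemma degIn_univ {V : Type*} [Fintype V] (H : SimpleGraph V) [DecidableRel H.Adj] (u : V) :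
    degIn H Finset.univ u = H.degree u := by
  rw [degIn, ← H.neighborFinset_eq_filter, H.card_neighborFinset_eq_degree]

section DegreeCount

variable {V : Type*} [Fintype V] [DecidableEq V] (H : SimpleGraph V) [DecidableRel H.Adj]

lemma degree_add_degree_le_card_edgeFinset_add_one {a b : V} (h : H.Adj a b) :
    H.degree a + H.degree b ≤ H.edgeFinset.card + 1 := by
  rw [← H.card_incidenceFinset_eq_degree, ← H.card_incidenceFinset_eq_degree,
    ← Finset.card_union_add_card_inter]
  refine add_le_add (Finset.card_le_card (Finset.union_subset (H.incidenceFinset_subset a)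
    (H.incidenceFinset_subset b))) ?_
  rw [← Finset.card_singleton s(a, b)]
  refine Finset.card_le_card fun e he => ?_
  have := H.incidenceSet_inter_incidenceSet_of_adj h
  simp only [Finset.mem_inter, SimpleGraph.mem_incidenceFinset] at he
  have he' : e ∈ H.incidenceSet a ∩ H.incidenceSet b := he
  rw [this] at he'
  simpa using he'

lemma sum_degree_sq_le : ∑ u, H.degree u ^ 2 ≤ H.edgeFinset.card * (H.edgeFinset.card + 1) := by
  have hdeg : ∀ (u : V) (c : ℕ), ∑ w, (if H.Adj u w then c else 0) = H.degree u * c := by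
    intro u c
    rw [← Finset.sum_filter, Finset.sum_const, smul_eq_mul, ← H.neighborFinset_eq_filter,
      H.card_neighborFinset_eq_degree]
  have h1 : ∑ u, ∑ w, (if H.Adj u w then H.degree u else 0) = ∑ u, H.degree u ^ 2 :=
    Finset.sum_congr rfl fun u _ => by rw [hdeg, pow_two]
  have h2 : ∑ u, ∑ w, (if H.Adj u w then H.degree w else 0) = ∑ u, H.degree u ^ 2 := by
    rw [← h1, Finset.sum_comm]
    simp only [H.adj_comm]
  have h3 : ∑ u, ∑ w, (if H.Adj u w then H.edgeFinset.card + 1 else 0) =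
      2 * H.edgeFinset.card * (H.edgeFinset.card + 1) := by
    simp only [hdeg]
    rw [← Finset.sum_mul, H.sum_degrees_eq_twice_card_edges]
  have h4 : ∑ u, ∑ w, (if H.Adj u w then H.degree u else 0) +
      ∑ u, ∑ w, (if H.Adj u w then H.degree w else 0) ≤
      ∑ u, ∑ w, (if H.Adj u w then H.edgeFinset.card + 1 else 0) := by
    rw [← Finset.sum_add_distrib]
    refine Finset.sum_le_sum fun u _ => ?_
    rw [← Finset.sum_add_distrib]
    refine Finset.sum_le_sum fun w _ => ?_
    split_ifs with h
    · exact degree_add_degree_le_card_edgeFinset_add_one H h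
    · simp
  rw [h1, h2, h3] at h4
  nlinarith

lemma sparse_arith {N k g t : ℤ} (hN : 17 ≤ N) (hk : 0 ≤ k) (ht : 0 ≤ t) (hg : 4 ≤ g)
    (hkg : k + g = N) (hk0 : k = 0 → t = 0) (hA : 2 * (k + t) * g + 8 < N ^ 2)
    (hB : t * (2 * N - 5 - t) + 8 < g ^ 2 + N - g)
    (hC : 2 * t * (g - 2) + 8 < g ^ 2 + N - g) :
    t + 4 ≤ g ∧ (t + 11 ≤ N ∨ k ≤ 3 ∧ t + 10 ≤ N) := by
  obtain rfl : g = N - k := by omega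
  rcases lt_or_ge 6 k with h6 | h6
  · have h1 : t + 4 ≤ N - k := by
      by_contra! hcon
      rcases le_or_gt t (N - 3) with h | h
      · have := mul_nonneg (show 0 ≤ t - (N - k - 3) by omega) (show 0 ≤ N - 3 - t by omega)
        nlinarith
      · nlinarith
    exact ⟨h1, by omega⟩
  · rcases lt_or_ge 3 k with h3 | h3
    · have h1 : t + 11 ≤ N := by
        by_contra! hcon
        have : 2 * (k + (N - 10)) * (N - k) ≤ 2 * (k + t) * (N - k) := by gcongr; omega
        interval_cases k <;> nlinarith
      omega
    · by_cases hk' : k = 0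
      · have := hk0 hk'
        omega
      · have h1 : t + 10 ≤ N := by
          by_contra! hcon
          have : 2 * (k + (N - 9)) * (N - k) ≤ 2 * (k + t) * (N - k) := by gcongr; omega
          have : 1 ≤ k := by omega
          interval_cases k <;> nlinarith
        omega

/-- If the degree sum `∑ d (N - d)` is small, then few edges avoid a vertex of maximum degree. -/
lemma exists_sum_degIn_erase_eq {N : ℕ} (hN : 17 ≤ N) (v : V)
    (hmax : ∀ u, H.degree u ≤ H.degree v) (hv : H.degree v + 4 ≤ N)
    (hsum : ∑ u, (H.degree u : ℤ) * (N - H.degree u) + 8 < (N : ℤ) ^ 2) :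
    ∃ t, ∑ u ∈ Finset.univ.erase v, degIn H (Finset.univ.erase v) u = 2 * t ∧
      t + H.degree v + 4 ≤ N ∧ (t + 11 ≤ N ∨ H.degree v ≤ 3 ∧ t + 10 ≤ N) := by
  set k := H.degree v with hk
  set Γ := H.deleteIncidenceSet v with hΓ
  set t := Γ.edgeFinset.card with ht
  set S := Finset.univ.erase v with hS
  have hΓdeg : ∀ u ∈ S, Γ.degree u = degIn H S u := by
    intro u hu
    rw [← Γ.card_neighborFinset_eq_degree, degIn]
    congr 1
    ext w
    simp only [SimpleGraph.mem_neighborFinset, hΓ, SimpleGraph.deleteIncidenceSet_adj,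
      Finset.mem_filter, hS, Finset.mem_erase, Finset.mem_univ, and_true]
    have := Finset.ne_of_mem_erase hu
    tauto
  have hΓv : Γ.degree v = 0 := by
    rw [← Γ.card_neighborFinset_eq_degree, Finset.card_eq_zero]
    ext w
    simp [hΓ, SimpleGraph.deleteIncidenceSet_adj]
  have htwo : ∑ u ∈ S, Γ.degree u = 2 * t := by
    rw [ht, ← Γ.sum_degrees_eq_twice_card_edges, ← Finset.add_sum_erase _ _ (Finset.mem_univ v),
      hΓv, zero_add]
  have hE : ∑ u ∈ S, degIn H S u = 2 * t := by
    rw [← htwo]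
    exact Finset.sum_congr rfl fun u hu => (hΓdeg u hu).symm
  have hsq : ∑ u ∈ S, Γ.degree u ^ 2 ≤ t * (t + 1) :=
    (Finset.sum_le_sum_of_subset (Finset.subset_univ S)).trans (sum_degree_sq_le Γ)
  let a : V → ℕ := fun u => if H.Adj u v then 1 else 0
  have hdeg : ∀ u ∈ S, H.degree u = Γ.degree u + a u := fun u hu => by
    rw [hΓdeg u hu, ← degIn_univ]
    exact (degIn_erase_add (Finset.mem_univ v) u).symm
  have ha : ∑ u ∈ S, a u = k := by
    rw [hk, ← degIn_univ, ← degIn_self_erase, degIn, Finset.card_filter]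
    simp only [a, H.adj_comm v]
    rfl
  have ha1 : ∀ u, a u ≤ 1 := fun u => by simp only [a]; split_ifs <;> simp
  have hak : ∀ u ∈ S, Γ.degree u ≤ k := fun u hu => by
    have := hdeg u hu
    have := hmax u
    omega
  have hsq' : ∑ u ∈ S, Γ.degree u ^ 2 ≤ 2 * t * k := by
    rw [← htwo, Finset.sum_mul]
    exact Finset.sum_le_sum fun u hu => by
      rw [pow_two]; exact Nat.mul_le_mul_left _ (hak u hu)
  have hat : ∑ u ∈ S, a u * Γ.degree u ≤ 2 * t := by
    rw [← htwo]
    exact Finset.sum_le_sum fun u _ => by nlinarith [ha1 u]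
  have hdsum : ∑ u ∈ S, H.degree u = 2 * t + k := by
    rw [Finset.sum_congr rfl hdeg, Finset.sum_add_distrib, htwo, ha]
  have hdsq : ∑ u ∈ S, H.degree u ^ 2 =
      ∑ u ∈ S, Γ.degree u ^ 2 + 2 * ∑ u ∈ S, a u * Γ.degree u + k := by
    rw [← ha, Finset.mul_sum, ← Finset.sum_add_distrib, ← Finset.sum_add_distrib]
    refine Finset.sum_congr rfl fun u hu => ?_
    rw [hdeg u hu]
    have : a u ^ 2 = a u := by simp only [a]; split_ifs <;> simp
    linear_combination this
  have hdsq' : ∑ u ∈ S, H.degree u ^ 2 ≤ (2 * t + k) * k := by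
    rw [← hdsum, Finset.sum_mul]
    exact Finset.sum_le_sum fun u _ => by
      rw [pow_two]; exact Nat.mul_le_mul_left _ (hmax u)
  rw [← Finset.add_sum_erase _ _ (Finset.mem_univ v), ← hk, ← hS] at hsum
  have hexp : ∑ u ∈ S, (H.degree u : ℤ) * (N - H.degree u) =
      N * (2 * t + k) - ((∑ u ∈ S, H.degree u ^ 2 : ℕ) : ℤ) := by
    have : ((2 * t + k : ℕ) : ℤ) = ∑ u ∈ S, (H.degree u : ℤ) := by rw [← hdsum]; push_cast; rfl
    push_cast at this ⊢
    rw [this, Finset.mul_sum, ← Finset.sum_sub_distrib]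
    exact Finset.sum_congr rfl fun u _ => by ring
  rw [hexp] at hsum
  have hk0 : k = 0 → t = 0 := by
    intro h0
    have : ∑ u ∈ S, Γ.degree u = 0 := Finset.sum_eq_zero fun u hu => by
      have := hak u hu; omega
    omega
  zify at hsq hsq' hat hdsq hdsq'
  push_cast at hsum
  obtain ⟨h1, h2⟩ := sparse_arith (N := N) (k := k) (g := N - k) (t := t) (by omega) (by omega)
    (by omega) (by omega) (by ring) (by exact_mod_cast hk0) (by nlinarith) (by nlinarith)
    (by nlinarith)
  exact ⟨t, hE, by omega, by omega⟩

lemma eight_mul_min_succ_le (d k : ℕ) :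
    8 * min (d + 1) k + 4 ≤ 2 * 12 + d * (d + 1) := by
  have h : 7 * d ≤ d * d + 12 := by
    rcases le_or_gt d 3 with h | h
    · interval_cases d <;> simp
    · nlinarith
  have := min_le_left (d + 1) k
  nlinarith

lemma eight_mul_min_succ_le_of_le_three {d k : ℕ} (hd : 1 ≤ d) (hk : k ≤ 3) :
    8 * min (d + 1) k + 4 ≤ 2 * 11 + d * (d + 1) := by
  rcases le_or_gt d 1 with h | h
  · interval_cases d
    omega
  · have : min (d + 1) k ≤ 3 := by omega
    nlinarith

/-- A graph with at least four non-neighbours at a vertex of maximum degree and small degree sum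
`∑ d (N - d)` has a complement containing a spanning square cycle. -/
theorem hasSqCycle_compl_of_sum_degree {N : ℕ} (hN : 17 ≤ N) (hcard : Fintype.card V = N + 1)
    (v : V) (hmax : ∀ u, H.degree u ≤ H.degree v) (hv : H.degree v + 4 ≤ N)
    (hsum : ∑ u, (H.degree u : ℤ) * (N - H.degree u) + 8 < (N : ℤ) ^ 2) :
    HasSqCycle Hᶜ Finset.univ (N + 1) := by
  obtain ⟨t, hE, h1, h2⟩ := exists_sum_degIn_erase_eq H hN v hmax hv hsum
  set S := Finset.univ.erase v with hS
  have hvS : v ∉ S := Finset.notMem_erase _ _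
  have hSuniv : insert v S = Finset.univ := Finset.insert_erase (Finset.mem_univ v)
  have hScard : S.card = N := by
    rw [hS, Finset.card_erase_of_mem (Finset.mem_univ v), Finset.card_univ, hcard]; rfl
  have hP : (S.filter fun u => ¬ H.Adj v u).card + H.degree v = N := by
    rw [← degIn_univ, ← degIn_self_erase, degIn, add_comm, ← hScard]
    exact Finset.card_filter_add_card_filter_not (s := S) (fun u => H.Adj v u)
  have key : ∀ c, (∀ d, 1 ≤ d → 8 * min (d + 1) (H.degree v) + 4 ≤ 2 * c + d * (d + 1)) →
      c + t ≤ N + 1 → HasSqCycle Hᶜ Finset.univ (N + 1) := by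
    intro c hc hct
    have := hasSqCycle_of_sparse (H := H) v c (H.degree v) hc S (S.filter fun u => ¬ H.Adj v u) hvS
      (Finset.filter_subset _ _) (fun u hu => (Finset.mem_filter.1 hu).2)
      (fun u _ => by rw [hSuniv, degIn_univ]; exact hmax u) (by omega) (by omega)
    rwa [hSuniv, hScard] at this
  rcases h2 with h2 | ⟨h3, h2⟩
  · exact key 12 (fun d _ => eight_mul_min_succ_le d _) (by omega)
  · exact key 11 (fun d hd => eight_mul_min_succ_le_of_le_three hd h3) (by omega)

end DegreeCount

section ExtremalGraph

/-- A graph with a vertex of degree at most three embeds spanningly into `KnDelS n`. -/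
lemma exists_perm_map_le_KnDelS {n : ℕ} (hn : 5 ≤ n) (G : SimpleGraph (Fin n))
    [DecidableRel G.Adj] {v : Fin n} (hv : G.degree v ≤ 3) :
    ∃ σ : Equiv.Perm (Fin n), ∀ a b, G.Adj a b → (KnDelS n).Adj (σ a) (σ b) := by
  classical
  obtain ⟨W, hW, hWv, hWcard⟩ : ∃ W, G.neighborFinset v ⊆ W ∧ W ⊆ Finset.univ.erase v ∧
      W.card = 3 := by
    refine Finset.exists_subsuperset_card_eq ?_ ?_ ?_
    · intro u hu
      simpa using (G.ne_of_adj ((G.mem_neighborFinset v u).1 hu)).symm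
    · simpa using hv
    · rw [Finset.card_erase_of_mem (Finset.mem_univ v)]; simp; omega
  have hvW : v ∉ W := fun h => Finset.notMem_erase v _ (hWv h)
  have hcard : Fintype.card {x // x ∈ W} = Fintype.card {i : Fin n // n ≤ i.val + 3} := by
    rw [Fintype.card_coe, hWcard, Fintype.card_subtype]
    obtain ⟨p, rfl⟩ : ∃ p, n = p + 3 := ⟨n - 3, by omega⟩
    rw [Finset.card_filter, Fin.sum_univ_castSucc, Fin.sum_univ_castSucc, Fin.sum_univ_castSucc,
      Finset.sum_eq_zero fun j _ => if_neg (by simp)]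
    simp
  let e := Fintype.equivOfCardEq hcard
  let τ := e.extendSubtype
  have hτW : ∀ x ∈ W, n ≤ (τ x).val + 3 := fun x hx => e.extendSubtype_mem x hx
  have hτv : ¬ n ≤ (τ v).val + 3 := e.extendSubtype_not_mem v hvW
  let z : Fin n := ⟨0, by omega⟩
  let σ := τ.trans (Equiv.swap (τ v) z)
  have hσW : ∀ x ∈ W, n ≤ (σ x).val + 3 := by
    intro x hx
    have hx' := hτW x hx
    have : σ x = τ x := by
      refine Equiv.swap_apply_of_ne_of_ne (fun h => hτv (h ▸ hx')) (fun h => ?_)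
      rw [h] at hx'
      simp only [z] at hx'
      omega
    rwa [this]
  have hσv : ∀ x, (σ x).val = 0 → x = v := by
    intro x hx
    have h1 : σ v = z := Equiv.swap_apply_left _ _
    exact σ.injective ((Fin.ext hx : σ x = z).trans h1.symm)
  refine ⟨σ, fun a b hab => KnDelS_adj.2 ⟨σ.injective.ne hab.ne, fun h => ?_, fun h => ?_⟩⟩
  · obtain rfl := hσv a h
    exact hσW b (hW ((G.mem_neighborFinset _ _).2 hab))
  · obtain rfl := hσv b h
    exact hσW a (hW ((G.mem_neighborFinset _ _).2 hab.symm))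

lemma pos_of_KnDelS_eigenvector {n : ℕ} (hn : 5 ≤ n) {y : Fin n → ℝ} (hy : ∀ i, 0 ≤ y i)
    (hy0 : y ≠ 0) (hmax : specRad (KnDelS n) * ∑ i, y i ^ 2 ≤ adjForm (KnDelS n) y) (i : Fin n) :
    0 < y i := by
  classical
  have heig := sum_adj_eq_of_le_adjForm hmax
  have hterm : ∀ a b, 0 ≤ if (KnDelS n).Adj a b then y b else 0 := fun a b => by
    split_ifs
    exacts [hy b, le_rfl]
  have hzero : ∀ a b, y a = 0 → (KnDelS n).Adj a b → y b = 0 := by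
    intro a b ha hab
    have h1 := heig a
    rw [ha, mul_zero, Finset.sum_eq_zero_iff_of_nonneg fun j _ => hterm a j] at h1
    simpa [hab] using h1 b (Finset.mem_univ b)
  let u : Fin n := ⟨n - 1, by omega⟩
  have hu : ∀ j, j ≠ u → (KnDelS n).Adj j u := by
    intro j hj
    refine KnDelS_adj.2 ⟨hj, ?_⟩
    simp only [u]
    omega
  have hu0 : y u ≠ 0 := fun h => hy0 (funext fun j => by
    by_cases hj : j = u
    · rw [hj, h]; rfl
    · exact hzero u j h (hu j hj).symm)
  refine (hy i).lt_of_ne' fun h => ?_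
  by_cases hi : i = u
  · exact hu0 (hi ▸ h)
  · exact hu0 (hzero i u h (hu i hi))

/-- `KnDelS n` has larger spectral radius than its proper spanning subgraphs. -/
lemma adj_of_specRad_KnDelS_le {n : ℕ} (hn : 5 ≤ n) {G : SimpleGraph (Fin n)}
    (h : specRad (KnDelS n) ≤ specRad G) {σ : Equiv.Perm (Fin n)}
    (hσ : ∀ a b, G.Adj a b → (KnDelS n).Adj (σ a) (σ b)) {a b : Fin n}
    (hab : (KnDelS n).Adj (σ a) (σ b)) : G.Adj a b := by
  classical
  have : Nonempty (Fin n) := ⟨a⟩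
  obtain ⟨x, hx, hx0, hmax⟩ := exists_perron G
  let y : Fin n → ℝ := fun i => x (σ.symm i)
  have hsq : ∑ i, y i ^ 2 = ∑ i, x i ^ 2 := Equiv.sum_comp σ.symm fun i => x i ^ 2
  have hform : adjForm (KnDelS n) y =
      ∑ i, ∑ j, if (KnDelS n).Adj (σ i) (σ j) then x i * x j else 0 := by
    rw [adjForm, ← Equiv.sum_comp σ]
    refine Finset.sum_congr rfl fun i _ => ?_
    rw [← Equiv.sum_comp σ]
    simp [y]
  have hterm : ∀ i j, (if G.Adj i j then x i * x j else 0) ≤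
      if (KnDelS n).Adj (σ i) (σ j) then x i * x j else 0 := by
    intro i j
    have := mul_nonneg (hx i) (hx j)
    by_cases hij : G.Adj i j
    · simp [hij, hσ i j hij]
    · rw [if_neg hij]; split_ifs <;> simp [this]
  have hle : adjForm G x ≤ adjForm (KnDelS n) y := by
    rw [hform]
    exact Finset.sum_le_sum fun i _ => Finset.sum_le_sum fun j _ => hterm i j
  have hlow : specRad (KnDelS n) * ∑ i, y i ^ 2 ≤ adjForm G x := by
    refine le_trans ?_ hmax
    rw [hsq]
    exact mul_le_mul_of_nonneg_right h (Finset.sum_nonneg fun i _ => sq_nonneg _)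
  have hy0 : y ≠ 0 := fun h0 => hx0 (funext fun i => by
    have := congrFun h0 (σ i)
    simpa [y] using this)
  have hpos := pos_of_KnDelS_eigenvector hn (fun i => hx _) hy0 (hlow.trans hle)
  have hxpos : ∀ i, 0 < x i := fun i => by simpa [y] using hpos (σ i)
  by_contra hnot
  have hlt : adjForm G x < adjForm (KnDelS n) y := by
    rw [hform]
    refine Finset.sum_lt_sum (fun i _ => Finset.sum_le_sum fun j _ => hterm i j)
      ⟨a, Finset.mem_univ a, Finset.sum_lt_sum (fun j _ => hterm a j) ⟨b, Finset.mem_univ b, ?_⟩⟩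
    rw [if_neg hnot, if_pos hab]
    exact mul_pos (hxpos a) (hxpos b)
  have := adjForm_le (KnDelS n) y
  linarith

end ExtremalGraph

lemma contains_cycleSq_of_hasSqCycle {n : ℕ} (hn : 3 ≤ n) {G : SimpleGraph (Fin n)}
    (h : HasSqCycle G Finset.univ n) : Contains G (cycleSq n) := by
  obtain ⟨f, hf, -, h1, h2⟩ := h
  have : NeZero n := ⟨by omega⟩
  have hval : ∀ (a : ZMod n) (i : ℕ), f (a + i : ZMod n).val = f (a.val + i) := by
    intro a i
    rw [hf, ← ZMod.natCast_eq_natCast_iff]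
    simp
  refine ⟨⟨fun a => f a.val, fun a b hab => ?_⟩, fun a b hab => ?_⟩
  · have := (hf _ _).1 hab
    rwa [← ZMod.natCast_eq_natCast_iff, ZMod.natCast_zmod_val, ZMod.natCast_zmod_val] at this
  · have key : ∀ a b : ZMod n, b - a = 1 ∨ b - a = 2 → G.Adj (f a.val) (f b.val) := by
      rintro a b (h | h)
      · obtain rfl : b = a + (1 : ℕ) := by rw [Nat.cast_one, ← h]; ring
        rw [hval]
        exact h1 _
      · obtain rfl : b = a + (2 : ℕ) := by rw [Nat.cast_ofNat, ← h]; ring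
        rw [hval]
        exact h2 _
    rcases ((SimpleGraph.fromRel_adj _ _ _).1 hab).2 with h | h
    · exact key a b h
    · exact (key b a h).symm

/-- Let `G` be a simple graph on `n ≥ 18` vertices. If
`μ(G) ≥ μ(K_n \ E(S_{n−3}))`, then `G` contains the 2-power of a Hamilton cycle, unless
`G = K_n \ E(S_{n−3})`. -/
theorem stmt1 (n : ℕ) (hn : 18 ≤ n) (G : SimpleGraph (Fin n))
    (h : specRad (KnDelS n) ≤ specRad G) :
    Contains G (cycleSq n) ∨ Nonempty (G ≃g KnDelS n) := by
  classical
  obtain ⟨N, rfl⟩ : ∃ N, n = N + 1 := ⟨n - 1, by omega⟩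
  obtain ⟨v, hv⟩ := Finite.exists_max fun u => Gᶜ.degree u
  have hdeg : Gᶜ.degree v + G.degree v = N := by
    have := G.degree_compl v
    have := G.degree_lt_card_verts v
    simp only [Fintype.card_fin] at *
    omega
  rcases le_or_gt (G.degree v) 3 with h3 | h3
  · obtain ⟨σ, hσ⟩ := exists_perm_map_le_KnDelS (by omega) G h3
    exact Or.inr ⟨⟨σ, fun {a b} => ⟨adj_of_specRad_KnDelS_le (by omega) h hσ, hσ a b⟩⟩⟩
  · left
    have hN : (17 : ℝ) ≤ N := by exact_mod_cast (by omega : 17 ≤ N)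
    have hcast : ((N + 1 : ℕ) : ℝ) = N + 1 := by push_cast; rfl
    have hsum := sum_compl_degree_mul_le G (N := N) (by linarith) (by simp)
      ((le_specRad_KnDelS (by omega) hcast).trans h)
    have hlt : ∑ u, (Gᶜ.degree u : ℝ) * (N - Gᶜ.degree u) + 8 < (N : ℝ) ^ 2 := by
      have : 9 * ((N : ℝ) - 1) / N > 8 := by
        rw [gt_iff_lt, lt_div_iff₀ (by linarith)]
        linarith
      linarith
    have hcyc := hasSqCycle_compl_of_sum_degree Gᶜ (N := N) (by omega) (by simp) v hv (by omega)
      (by exact_mod_cast hlt)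
    rw [compl_compl] at hcyc
    exact contains_cycleSq_of_hasSqCycle (by omega) hcyc
end
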